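/- arXiv:1405.0617 — 3 statements merged into one kernel-verified Lean document; each statement's English description precedes it below -/
import Mathlib

section
/- Let Ω ⊂ ℝⁿ be a bounded convex domain and let P^N_Ω, P^H_Ω, and P^D (Faber–Krahn) be defined as in context. If every smooth f on Ω decomposes as f = (f−h) + h with h harmonic and h = f on ∂Ω, then Var_{λ_Ω}(f) ≤ max(C₁|Ω|^{2/n}/n, 2P^H_Ω)·∫_Ω |∇f|² dλ_Ω; in particular P^N_Ω ≤ C·P^H_Ω for a universal constant C. -/
open MeasureTheory Metric Set
open scoped RealInnerProductSpace ENNReal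

/-- The variance of `f` under the measure `μ`. -/
noncomputable def var' {α : Type*} [MeasurableSpace α] (μ : Measure α) (f : α → ℝ) : ℝ :=
  (∫ x, f x ^ 2 ∂μ) - (∫ x, f x ∂μ) ^ 2

/-- `h` is harmonic on `s` : its Euclidean Laplacian vanishes on `s`. -/
def IsHarmonicOn {n : ℕ} (h : EuclideanSpace ℝ (Fin n) → ℝ)
    (s : Set (EuclideanSpace ℝ (Fin n))) : Prop :=
  ∀ x ∈ s, ∑ i, fderiv ℝ (fun y => fderiv ℝ h y (EuclideanSpace.single i 1)) x
    (EuclideanSpace.single i 1) = 0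

section HelperSection

open scoped FourierTransform LineDeriv SchwartzMap ContDiff

lemma one_le_exp_add {a s : ℝ} (ha : 0 < a) (hs : 0 ≤ s) : 1 ≤ Real.exp (a - s) + s / a := by
  rcases le_total s a with h | h
  · have : 1 ≤ Real.exp (a - s) := Real.one_le_exp (by linarith)
    have : 0 ≤ s / a := by positivity
    linarith
  · have : 1 ≤ s / a := (one_le_div ha).2 h
    have := Real.exp_pos (a - s)
    linarith

noncomputable def tq (n : ℕ) (q : ℝ) : ℝ := Real.pi * Real.exp 1 * (2 * q) ^ ((2 : ℝ) / n)

lemma tq_pos {n : ℕ} {q : ℝ} (hq : 0 < q) : 0 < tq n q := by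
  unfold tq; positivity

lemma gauss_int {n : ℕ} {q : ℝ} (hq : 0 < q) :
    Integrable (fun x : EuclideanSpace ℝ (Fin n) => Real.exp (n / 2 - tq n q * ‖x‖ ^ 2)) := by
  have h : Integrable (fun x : EuclideanSpace ℝ (Fin n) => Real.exp (- tq n q * ‖x‖ ^ 2)) := by
    by_contra hcon
    have h1 := GaussianFourier.integral_rexp_neg_mul_sq_norm (V := EuclideanSpace ℝ (Fin n))
      (tq_pos (n := n) hq)
    rw [integral_undef hcon] at h1
    have := tq_pos (n := n) hq
    have : 0 < (Real.pi / tq n q) ^ (Module.finrank ℝ (EuclideanSpace ℝ (Fin n)) / 2 : ℝ) := by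
      positivity
    linarith
  refine (h.const_mul (Real.exp (n / 2))).congr (ae_of_all _ fun x => ?_)
  simp only [← Real.exp_add]
  congr 1; ring

lemma gauss_mass {n : ℕ} (hn : 0 < n) {q : ℝ} (hq : 0 < q) :
    ∫ x : EuclideanSpace ℝ (Fin n), Real.exp (n / 2 - tq n q * ‖x‖ ^ 2) = 1 / (2 * q) := by
  have h1 := GaussianFourier.integral_rexp_neg_mul_sq_norm (V := EuclideanSpace ℝ (Fin n))
      (tq_pos (n := n) hq)
  have h2 : ∀ x : EuclideanSpace ℝ (Fin n), Real.exp (n / 2 - tq n q * ‖x‖ ^ 2) =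
      Real.exp (n / 2) * Real.exp (- tq n q * ‖x‖ ^ 2) := fun x => by
    rw [← Real.exp_add]; congr 1; ring
  simp_rw [h2]
  rw [integral_const_mul, h1]
  have hn' : (n : ℝ) ≠ 0 := by positivity
  have h3 : Real.pi / tq n q = Real.exp (-1) * (2 * q) ^ (-(2 : ℝ) / n) := by
    unfold tq
    rw [neg_div, Real.rpow_neg (by positivity), Real.exp_neg]
    have := Real.pi_pos
    field_simp
  rw [h3, Real.mul_rpow (by positivity) (by positivity), ← Real.exp_mul, ← Real.rpow_mul (by positivity),
    finrank_euclideanSpace_fin, ← mul_assoc, ← Real.exp_add]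
  have e1 : (n : ℝ) / 2 + -1 * (n / 2) = 0 := by ring
  have e2 : -(2 : ℝ) / n * (n / 2) = -1 := by field_simp
  rw [e1, e2, Real.exp_zero, Real.rpow_neg_one]; simp

lemma tq_le {n : ℕ} (hn : 2 ≤ n) {q : ℝ} (hq : 0 < q) :
    tq n q ≤ 2 * Real.pi * Real.exp 1 * q ^ ((2 : ℝ) / n) := by
  unfold tq
  rw [Real.mul_rpow (by norm_num) hq.le]
  have : (2 : ℝ) ^ ((2 : ℝ) / n) ≤ 2 := by
    have hn' : (2 : ℝ) ≤ n := by exact_mod_cast hn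
    calc (2 : ℝ) ^ ((2 : ℝ) / n) ≤ 2 ^ (1 : ℝ) :=
          Real.rpow_le_rpow_of_exponent_le (by norm_num) ((div_le_one (by linarith)).2 hn')
      _ = 2 := by simp
  have hp := Real.pi_pos
  calc Real.pi * Real.exp 1 * (2 ^ ((2 : ℝ) / n) * q ^ ((2 : ℝ) / n))
      ≤ Real.pi * Real.exp 1 * (2 * q ^ ((2 : ℝ) / n)) := by gcongr
    _ = _ := by ring

set_option maxHeartbeats 400000 in
/-- Faber–Krahn type inequality for test functions. -/
lemma fk_test {n : ℕ} (hn : 2 ≤ n) (w : EuclideanSpace ℝ (Fin n) → ℝ) (hw : ContDiff ℝ ∞ w)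
    (hc : HasCompactSupport w) {V : ℝ} (hV : 0 < V) (h1 : (∫ x, |w x|) ^ 2 ≤ V * ∫ x, w x ^ 2) :
    ∫ x, w x ^ 2 ≤ (2 * Real.exp 1 / Real.pi) * V ^ ((2 : ℝ) / n) / n *
      ∫ x, ∑ i, (fderiv ℝ w x (EuclideanSpace.single i 1)) ^ 2 := by
  have hcC : HasCompactSupport (fun x => (w x : ℂ)) := hc.comp_left (g := fun r : ℝ => (r : ℂ)) (by simp)
  have hwC : ContDiff ℝ ∞ (fun x => (w x : ℂ)) := Complex.ofRealCLM.contDiff.comp hw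
  obtain ⟨f, fx⟩ : ∃ f : 𝓢(EuclideanSpace ℝ (Fin n), ℂ), ∀ x, f x = (w x : ℂ) :=
    ⟨hcC.toSchwartzMap hwC, fun x => rfl⟩
  have hint : ∀ g : 𝓢(EuclideanSpace ℝ (Fin n), ℂ), Integrable (fun x => ‖g x‖ ^ 2) := fun g =>
    (g.memLp 2).integrable_norm_pow (by norm_num)
  have P0 : ∫ ξ, ‖𝓕 f ξ‖ ^ 2 = ∫ x, w x ^ 2 := by
    rw [SchwartzMap.integral_norm_sq_fourier]; simp [fx]
  have F1 : ∀ (i : Fin n) ξ, ‖𝓕 (∂_{EuclideanSpace.single i (1 : ℝ)} f) ξ‖ ^ 2 =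
      4 * Real.pi ^ 2 * (ξ i ^ 2 * ‖𝓕 f ξ‖ ^ 2) := by
    intro i ξ
    have : (inner ℝ · (EuclideanSpace.single i (1 : ℝ)) : EuclideanSpace ℝ (Fin n) → ℝ).HasTemperateGrowth :=
      ((innerSL ℝ).flip (EuclideanSpace.single i (1 : ℝ))).hasTemperateGrowth
    rw [SchwartzMap.fourier_lineDerivOp_eq]
    rw [smul_apply, SchwartzMap.smulLeftCLM_apply_apply this]
    simp only [norm_smul, norm_mul, mul_pow, EuclideanSpace.inner_single_right, Complex.norm_ofNat,
      Complex.norm_real, Complex.norm_I, Real.norm_eq_abs, sq_abs]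
    simp
    norm_num
  have D1 : ∀ (i : Fin n) x, ‖(∂_{EuclideanSpace.single i (1 : ℝ)} f) x‖ ^ 2 =
      (fderiv ℝ w x (EuclideanSpace.single i 1)) ^ 2 := by
    intro i x
    rw [SchwartzMap.lineDerivOp_apply_eq_fderiv]
    have : HasFDerivAt (fun x => (w x : ℂ)) (Complex.ofRealCLM.comp (fderiv ℝ w x)) x :=
      Complex.ofRealCLM.hasFDerivAt.comp x ((hw.differentiable (by simp)) x).hasFDerivAt
    have e : fderiv ℝ (f : EuclideanSpace ℝ (Fin n) → ℂ) x = Complex.ofRealCLM.comp (fderiv ℝ w x) := by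
      rw [← this.fderiv]; congr 1; ext y; exact fx y
    rw [e]; simp
  have P1 : ∀ i : Fin n, ∫ ξ : EuclideanSpace ℝ (Fin n), (ξ i ^ 2 * ‖𝓕 f ξ‖ ^ 2) = (4 * Real.pi ^ 2)⁻¹ *
      ∫ x, (fderiv ℝ w x (EuclideanSpace.single i 1)) ^ 2 := by
    intro i
    have h := SchwartzMap.integral_norm_sq_fourier (∂_{EuclideanSpace.single i (1 : ℝ)} f)
    simp_rw [F1, D1] at h
    rw [integral_const_mul] at h
    rw [← h]
    have := Real.pi_pos
    field_simp
  have I1 : ∀ i : Fin n, Integrable (fun ξ : EuclideanSpace ℝ (Fin n) => ξ i ^ 2 * ‖𝓕 f ξ‖ ^ 2) := by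
    intro i
    have h := hint (𝓕 (∂_{EuclideanSpace.single i (1 : ℝ)} f))
    simp_rw [F1] at h
    refine (h.const_mul (4 * Real.pi ^ 2)⁻¹).congr (ae_of_all _ fun x => ?_)
    have := Real.pi_pos
    simp only
    field_simp
  have I2 : ∀ i : Fin n, Integrable (fun x => (fderiv ℝ w x (EuclideanSpace.single i 1)) ^ 2) := by
    intro i
    have h := hint (∂_{EuclideanSpace.single i (1 : ℝ)} f)
    simp_rw [D1] at h
    exact h
  have nsq : ∀ ξ : EuclideanSpace ℝ (Fin n), ‖ξ‖ ^ 2 * ‖𝓕 f ξ‖ ^ 2 = ∑ i, ξ i ^ 2 * ‖𝓕 f ξ‖ ^ 2 := by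
    intro ξ
    rw [EuclideanSpace.real_norm_sq_eq, Finset.sum_mul]
  have I3 : Integrable (fun ξ : EuclideanSpace ℝ (Fin n) => ‖ξ‖ ^ 2 * ‖𝓕 f ξ‖ ^ 2) := by
    simp_rw [nsq]
    exact integrable_finsetSum _ fun i _ => I1 i
  have P2 : ∫ ξ : EuclideanSpace ℝ (Fin n), ‖ξ‖ ^ 2 * ‖𝓕 f ξ‖ ^ 2 = (4 * Real.pi ^ 2)⁻¹ *
      ∫ x, ∑ i, (fderiv ℝ w x (EuclideanSpace.single i 1)) ^ 2 := by
    simp_rw [nsq]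
    rw [integral_finsetSum _ fun i _ => I1 i, integral_finsetSum _ fun i _ => I2 i, Finset.mul_sum]
    exact Finset.sum_congr rfl fun i _ => P1 i
  set D := ∫ x, ∑ i, (fderiv ℝ w x (EuclideanSpace.single i 1)) ^ 2 with hD
  have hD0 : 0 ≤ D := integral_nonneg fun x => Finset.sum_nonneg fun i _ => sq_nonneg _
  set S := ∫ x, w x ^ 2 with hS
  have bnd : ∀ ξ, ‖𝓕 f ξ‖ ^ 2 ≤ V * S := by
    intro ξ
    refine le_trans ?_ h1
    have : ‖𝓕 f ξ‖ ≤ ∫ x, |w x| := by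
      rw [SchwartzMap.fourier_coe, Real.fourier_eq]
      refine (norm_integral_le_integral_norm _).trans (le_of_eq ?_)
      simp [fx]
    gcongr
  have hnpos : (0 : ℝ) < n := by positivity
  set t := tq n V with ht
  have htpos : 0 < t := tq_pos hV
  have key : S ≤ S / 2 + t / (n / 2) * ((4 * Real.pi ^ 2)⁻¹ * D) := by
    calc S = ∫ ξ, ‖𝓕 f ξ‖ ^ 2 := P0.symm
      _ ≤ ∫ ξ, ((V * S) * Real.exp (n / 2 - t * ‖ξ‖ ^ 2) + t / (n / 2) * (‖ξ‖ ^ 2 * ‖𝓕 f ξ‖ ^ 2)) := by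
          refine integral_mono (hint _) (((gauss_int hV).const_mul _).add (I3.const_mul _)) fun ξ => ?_
          have h := one_le_exp_add (a := (n : ℝ) / 2) (s := t * ‖ξ‖ ^ 2) (by positivity) (by positivity)
          calc ‖𝓕 f ξ‖ ^ 2 = 1 * ‖𝓕 f ξ‖ ^ 2 := by ring
            _ ≤ (Real.exp (n / 2 - t * ‖ξ‖ ^ 2) + t * ‖ξ‖ ^ 2 / (n / 2)) * ‖𝓕 f ξ‖ ^ 2 := by gcongr
            _ = ‖𝓕 f ξ‖ ^ 2 * Real.exp (n / 2 - t * ‖ξ‖ ^ 2) + t / (n / 2) * (‖ξ‖ ^ 2 * ‖𝓕 f ξ‖ ^ 2) := by ring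
            _ ≤ _ := by gcongr; exact bnd ξ
      _ = S / 2 + t / (n / 2) * ((4 * Real.pi ^ 2)⁻¹ * D) := by
          rw [integral_add ((gauss_int hV).const_mul _) (I3.const_mul _), integral_const_mul,
            integral_const_mul, gauss_mass (by omega) hV, P2]
          congr 1
          field_simp
  have key2 : S ≤ t / n * (Real.pi ^ 2)⁻¹ * D := by
    have : t / (n / 2) * ((4 * Real.pi ^ 2)⁻¹ * D) = t / n * (Real.pi ^ 2)⁻¹ * D / 2 := by
      field_simp; ring
    linarith
  refine key2.trans ?_
  have hp := Real.pi_pos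
  calc t / n * (Real.pi ^ 2)⁻¹ * D ≤ (2 * Real.pi * Real.exp 1 * V ^ ((2 : ℝ) / n)) / n * (Real.pi ^ 2)⁻¹ * D := by
        gcongr; exact tq_le hn hV
    _ = _ := by field_simp

lemma exists_cutoff : ∃ (g : ℝ → ℝ) (M : ℝ), ContDiff ℝ ∞ g ∧ HasCompactSupport g ∧
    (∀ s, |s| ≤ 1 → g s = s) ∧ 0 ≤ M ∧ (∀ s, |g s| ≤ M) ∧ (∀ s, |deriv g s| ≤ M) := by
  let φ : ContDiffBump (0 : ℝ) := ⟨1, 2, by norm_num, by norm_num⟩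
  have h1 : ContDiff ℝ ∞ (fun s : ℝ => s * φ s) := contDiff_id.mul φ.contDiff
  have h2 : HasCompactSupport (fun s : ℝ => s * φ s) := φ.hasCompactSupport.mul_left
  obtain ⟨M1, hM1⟩ := h1.continuous.bounded_above_of_compact_support h2
  obtain ⟨M2, hM2⟩ := (h1.continuous_deriv (by simp)).bounded_above_of_compact_support h2.deriv
  refine ⟨fun s => s * φ s, max M1 M2, h1, h2, ?_, ?_, ?_, ?_⟩
  · intro s hs
    have : φ s = 1 := φ.one_of_mem_closedBall (by simpa [φ] using hs)
    simp [this]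
  · exact le_max_of_le_left ((norm_nonneg _).trans (hM1 0))
  · exact fun s => le_max_of_le_left (hM1 s)
  · exact fun s => le_max_of_le_right (hM2 s)

/-- truncation of `u` supported inside `U`. -/
noncomputable def wk {n : ℕ} (g : ℝ → ℝ) (U : Set (EuclideanSpace ℝ (Fin n)))
    (u : EuclideanSpace ℝ (Fin n) → ℝ) (δ : ℝ) : EuclideanSpace ℝ (Fin n) → ℝ :=
  U.indicator (fun x => u x - δ * g (u x / δ))

section
variable {n : ℕ} {g : ℝ → ℝ} {Ω : Set (EuclideanSpace ℝ (Fin n))}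
    {u : EuclideanSpace ℝ (Fin n) → ℝ} {δ : ℝ}

lemma wk_eq_zero (hg1 : ∀ s, |s| ≤ 1 → g s = s)
    (hu : Continuous u) (h0 : ∀ x ∈ frontier Ω, u x = 0) (hδ : 0 < δ)
    {x : EuclideanSpace ℝ (Fin n)} (hx : x ∉ interior Ω) :
    wk g (interior Ω) u δ =ᶠ[nhds x] fun _ => 0 := by
  by_cases hc : x ∈ closure Ω
  · have hf : u x = 0 := h0 x ⟨hc, hx⟩
    have : ∀ᶠ y in nhds x, |u y| < δ := by
      have := (hu.abs.tendsto x)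
      rw [hf, abs_zero] at this
      exact this.eventually (gt_mem_nhds hδ)
    filter_upwards [this] with y hy
    unfold wk
    by_cases hyU : y ∈ interior Ω
    · rw [indicator_of_mem hyU, hg1]
      · field_simp; ring
      · rw [abs_div, abs_of_pos hδ]; exact (div_le_one hδ).2 hy.le
    · exact indicator_of_notMem hyU _
  · filter_upwards [isClosed_closure.isOpen_compl.mem_nhds hc] with y hy
    exact indicator_of_notMem (fun h => hy (subset_closure (interior_subset h))) _

lemma wk_eq {x : EuclideanSpace ℝ (Fin n)} (hx : x ∈ interior Ω) :
    wk g (interior Ω) u δ =ᶠ[nhds x] fun x => u x - δ * g (u x / δ) := by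
  filter_upwards [isOpen_interior.mem_nhds hx] with y hy
  exact indicator_of_mem hy _

lemma wk_contDiff (hg : ContDiff ℝ ∞ g) (hg1 : ∀ s, |s| ≤ 1 → g s = s)
    (hu : ContDiff ℝ ∞ u) (h0 : ∀ x ∈ frontier Ω, u x = 0) (hδ : 0 < δ) :
    ContDiff ℝ ∞ (wk g (interior Ω) u δ) := by
  rw [contDiff_iff_contDiffAt]
  intro x
  by_cases hx : x ∈ interior Ω
  · refine ContDiffAt.congr_of_eventuallyEq ?_ (wk_eq hx)
    exact (hu.sub (contDiff_const.mul (hg.comp (hu.div_const δ)))).contDiffAt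
  · exact contDiffAt_const.congr_of_eventuallyEq (wk_eq_zero hg1 hu.continuous h0 hδ hx)

lemma wk_compact (hb : Bornology.IsBounded Ω) :
    HasCompactSupport (wk g (interior Ω) u δ) := by
  refine HasCompactSupport.intro (K := closure Ω) hb.isCompact_closure fun x hx => ?_
  exact indicator_of_notMem (fun h => hx (subset_closure (interior_subset h))) _

lemma wk_fderiv (hg : ContDiff ℝ ∞ g) (hg1 : ∀ s, |s| ≤ 1 → g s = s)
    (hu : ContDiff ℝ ∞ u) (h0 : ∀ x ∈ frontier Ω, u x = 0) (hδ : 0 < δ)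
    (x v : EuclideanSpace ℝ (Fin n)) :
    fderiv ℝ (wk g (interior Ω) u δ) x v =
      (interior Ω).indicator (fun x => (1 - deriv g (u x / δ)) * fderiv ℝ u x v) x := by
  by_cases hx : x ∈ interior Ω
  · rw [(wk_eq hx).fderiv_eq, indicator_of_mem hx]
    have hud : HasFDerivAt u (fderiv ℝ u x) x := ((hu.differentiable (by simp)) x).hasFDerivAt
    have hgd : HasDerivAt g (deriv g (u x / δ)) (u x / δ) :=
      ((hg.differentiable (by simp)) _).hasDerivAt
    have hud2 : HasFDerivAt (fun x => u x / δ) (δ⁻¹ • fderiv ℝ u x) x := by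
      simpa [div_eq_inv_mul] using hud.const_mul δ⁻¹
    have := hud.sub ((hgd.comp_hasFDerivAt x hud2).const_mul δ)
    have e := this.fderiv
    simp only [Pi.sub_def, Function.comp_def] at e
    rw [e]
    simp
    field_simp
  · rw [(wk_eq_zero hg1 hu.continuous h0 hδ hx).fderiv_eq, indicator_of_notMem hx]
    simp

/-- The derivative vanishes a.e. on the zero set. -/
lemma fderiv_ae_zero (hn : 0 < n) (hu : ContDiff ℝ ∞ u) :
    ∀ᵐ x, u x = 0 → fderiv ℝ u x = 0 := by
  let e : EuclideanSpace ℝ (Fin n) := EuclideanSpace.single ⟨0, hn⟩ 1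
  have he : e ≠ 0 := by simp [e]
  let F : EuclideanSpace ℝ (Fin n) → EuclideanSpace ℝ (Fin n) := fun x => u x • e
  let s : Set (EuclideanSpace ℝ (Fin n)) := {x | u x = 0}
  have hs : MeasurableSet s := (isClosed_eq hu.continuous continuous_const).measurableSet
  have hA : ApproximatesLinearOn F (0 : EuclideanSpace ℝ (Fin n) →L[ℝ] EuclideanSpace ℝ (Fin n)) s 0 := by
    intro x hx y hy
    have hx' : u x = 0 := hx
    have hy' : u y = 0 := hy
    simp [F, hx', hy']
  have h := hA.norm_fderiv_sub_le volume hs (fun x => (fderiv ℝ u x).smulRight e) (fun x _ =>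
    (((hu.differentiable (by simp)) x).hasFDerivAt.smul_const e).hasFDerivWithinAt)
  rw [ae_restrict_iff' hs] at h
  filter_upwards [h] with x hx hux
  have h1 := hx hux
  rw [sub_zero, nonpos_iff_eq_zero, nnnorm_eq_zero] at h1
  ext v
  have := congrArg (fun L => L v) h1
  simpa [he] using this

lemma tendsto_coef {c : ℕ → EuclideanSpace ℝ (Fin n) → ℝ} {F : EuclideanSpace ℝ (Fin n) → ℝ}
    {ν : Measure (EuclideanSpace ℝ (Fin n))} (hF : Integrable F ν) {B : ℝ}
    (hc : ∀ k, Continuous (c k)) (hB : ∀ k x, |c k x| ≤ B)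
    (hl : ∀ᵐ x ∂ν, F x = 0 ∨ ∀ᶠ k in Filter.atTop, c k x = 1) :
    Filter.Tendsto (fun k => ∫ x, c k x * F x ∂ν) Filter.atTop (nhds (∫ x, F x ∂ν)) := by
  refine tendsto_integral_of_dominated_convergence (fun x => B * |F x|) ?_ (hF.abs.const_mul B) ?_ ?_
  · exact fun k => (hc k).aestronglyMeasurable.mul hF.aestronglyMeasurable
  · intro k
    refine ae_of_all _ fun x => ?_
    rw [Real.norm_eq_abs, abs_mul]
    exact mul_le_mul_of_nonneg_right (hB k x) (abs_nonneg _)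
  · filter_upwards [hl] with x hx
    rcases hx with h | h
    · simp [h]
    · refine tendsto_const_nhds.congr' ?_
      filter_upwards [h] with k hk
      simp [hk]

lemma deriv_cutoff_eventually (hc : HasCompactSupport g) {s : ℝ} (hs : s ≠ 0) :
    ∀ᶠ k : ℕ in Filter.atTop, deriv g (s / (1 / ((k : ℝ) + 1))) = 0 := by
  obtain ⟨R, hR⟩ := hc.deriv.isCompact.isBounded.exists_norm_le
  obtain ⟨N, hN⟩ := exists_nat_gt (R / |s|)
  filter_upwards [Filter.eventually_ge_atTop N] with k hk
  by_contra hne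
  have h1 := hR _ (subset_tsupport _ (Function.mem_support.2 hne))
  have hs' : 0 < |s| := abs_pos.2 hs
  rw [div_lt_iff₀ hs'] at hN
  have hk' : (N : ℝ) ≤ k := by exact_mod_cast hk
  rw [Real.norm_eq_abs, div_div_eq_mul_div, div_one, abs_mul, abs_of_pos (by positivity : (0:ℝ) < k + 1)] at h1
  nlinarith

end

lemma int_bdd {n : ℕ} {Ω : Set (EuclideanSpace ℝ (Fin n))} (hb : Bornology.IsBounded Ω)
    {F : EuclideanSpace ℝ (Fin n) → ℝ} (hF : Continuous F) :
    Integrable F (volume.restrict Ω) :=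
  (hF.continuousOn.integrableOn_compact (hb.isCompact_closure)).mono_set subset_closure

lemma cs_aux {n : ℕ} {U : Set (EuclideanSpace ℝ (Fin n))} (hb : Bornology.IsBounded U)
    {w : EuclideanSpace ℝ (Fin n) → ℝ} (hw : Continuous w) (h0 : ∀ x ∉ U, w x = 0) :
    (∫ x, |w x|) ^ 2 ≤ (volume U).toReal * ∫ x, w x ^ 2 := by
  have e1 : ∫ x, |w x| = ∫ x in U, |w x| :=
    (setIntegral_eq_integral_of_forall_compl_eq_zero fun x hx => by simp [h0 x hx]).symm
  have e2 : ∫ x, w x ^ 2 = ∫ x in U, w x ^ 2 :=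
    (setIntegral_eq_integral_of_forall_compl_eq_zero fun x hx => by simp [h0 x hx]).symm
  rw [e1, e2]
  set V := (volume U).toReal
  have hfin : volume U ≠ ⊤ := hb.measure_lt_top.ne
  have hV0 : 0 ≤ V := ENNReal.toReal_nonneg
  have : IsFiniteMeasure (volume.restrict U) := ⟨by simpa using hfin.lt_top⟩
  set m := ∫ x in U, |w x| with hm
  have i1 := int_bdd hb hw.abs
  have i2 : Integrable (fun x => w x ^ 2) (volume.restrict U) := int_bdd hb (hw.pow 2)
  have h : 0 ≤ ∫ x in U, (V * |w x| - m) ^ 2 := integral_nonneg fun x => sq_nonneg _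
  have e3 : ∫ x in U, (V * |w x| - m) ^ 2 = V ^ 2 * (∫ x in U, w x ^ 2) - 2 * V * m * m + V * m ^ 2 := by
    have : ∀ x, (V * |w x| - m) ^ 2 = V ^ 2 * w x ^ 2 - 2 * V * m * |w x| + m ^ 2 := fun x => by
      rw [sub_sq, mul_pow, sq_abs]; ring
    simp_rw [this]
    have j : Integrable (fun x => V ^ 2 * w x ^ 2 - 2 * V * m * |w x|) (volume.restrict U) :=
      (i2.const_mul _).sub (i1.const_mul _)
    rw [integral_add j (integrable_const _),
      integral_sub (i2.const_mul _) (i1.const_mul _), integral_const_mul, integral_const_mul]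
    simp [Measure.real, V, hm]
  rw [e3] at h
  rcases hV0.eq_or_lt with h' | h'
  · have hz : volume.restrict U = 0 := by
      rw [Measure.restrict_eq_zero]
      rcases (ENNReal.toReal_eq_zero_iff _).1 h'.symm with h | h
      · exact h
      · exact absurd h hfin
    simp [hm, hz]
  · have : 0 ≤ V * (V * (∫ x in U, w x ^ 2) - m ^ 2) := by nlinarith
    have := nonneg_of_mul_nonneg_right this h'
    linarith

section
variable {n : ℕ} {Ω : Set (EuclideanSpace ℝ (Fin n))}
    {u h : EuclideanSpace ℝ (Fin n) → ℝ}

lemma cont_d (hu : ContDiff ℝ ∞ u) (v : EuclideanSpace ℝ (Fin n)) :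
    Continuous (fun x => fderiv ℝ u x v) :=
  (hu.continuous_fderiv (by simp)).clm_apply continuous_const

lemma contDiff_d (hu : ContDiff ℝ ∞ u) (v : EuclideanSpace ℝ (Fin n)) :
    ContDiff ℝ ∞ (fun x => fderiv ℝ u x v) :=
  (hu.fderiv_right (m := ∞) (by simp)).clm_apply contDiff_const

/-- Faber–Krahn for functions vanishing on the frontier. -/
lemma fk_dirichlet (hn : 2 ≤ n) (hb : Bornology.IsBounded Ω)
    (hu : ContDiff ℝ ∞ u) (h0 : ∀ x ∈ frontier Ω, u x = 0)
    (hV : 0 < (volume (interior Ω)).toReal) :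
    ∫ x in interior Ω, u x ^ 2 ≤
      (2 * Real.exp 1 / Real.pi) * (volume (interior Ω)).toReal ^ ((2 : ℝ) / n) / n *
      ∫ x in interior Ω, ∑ i, (fderiv ℝ u x (EuclideanSpace.single i 1)) ^ 2 := by
  obtain ⟨g, M, hg, hgc, hg1, hM, hgM, hgM'⟩ := exists_cutoff
  have hbU : Bornology.IsBounded (interior Ω) := hb.subset interior_subset
  have hmU : MeasurableSet (interior Ω) := isOpen_interior.measurableSet
  set U := interior Ω with hUdef
  set K := (2 * Real.exp 1 / Real.pi) * (volume U).toReal ^ ((2 : ℝ) / n) / n with hK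
  have : IsFiniteMeasure (volume.restrict U) := ⟨by simpa using hbU.measure_lt_top⟩
  let δ : ℕ → ℝ := fun k => 1 / ((k : ℝ) + 1)
  have hδ : ∀ k, 0 < δ k := fun k => by positivity
  have hFc : Continuous (fun x => ∑ i, (fderiv ℝ u x (EuclideanSpace.single i 1)) ^ 2) :=
    continuous_finsetSum _ fun i _ => (cont_d hu _).pow 2
  have hdc : ∀ k, Continuous fun x => 1 - deriv g (u x / δ k) := fun k =>
    continuous_const.sub ((hg.continuous_deriv (by simp)).comp (hu.continuous.div_const _))
  have hdb : ∀ k x, |1 - deriv g (u x / δ k)| ≤ 1 + M := fun k x =>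
    (abs_sub _ _).trans (by have := hgM' (u x / δ k); simpa using this)
  have ineq : ∀ k, ∫ x in U, (u x - δ k * g (u x / δ k)) ^ 2 ≤
      K * ∫ x in U, (1 - deriv g (u x / δ k)) ^ 2 * ∑ i, (fderiv ℝ u x (EuclideanSpace.single i 1)) ^ 2 := by
    intro k
    have hwc := wk_contDiff hg hg1 hu h0 (hδ k)
    have := fk_test hn _ hwc (wk_compact hb) hV (cs_aux hbU hwc.continuous
      fun x hx => indicator_of_notMem hx _)
    convert this using 1
    · rw [← integral_indicator hmU]
      congr 1; ext x
      by_cases hx : x ∈ U <;> simp [wk, hx, ← hUdef]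
    · rw [← integral_indicator hmU]
      congr 2; ext x
      simp_rw [wk_fderiv hg hg1 hu h0 (hδ k)]
      by_cases hx : x ∈ U <;> simp [hx, ← hUdef, mul_pow, Finset.mul_sum]
  have T2 : Filter.Tendsto (fun k => ∫ x in U, (1 - deriv g (u x / δ k)) ^ 2 *
      ∑ i, (fderiv ℝ u x (EuclideanSpace.single i 1)) ^ 2) Filter.atTop
      (nhds (∫ x in U, ∑ i, (fderiv ℝ u x (EuclideanSpace.single i 1)) ^ 2)) := by
    refine tendsto_coef (B := (1 + M) ^ 2) (int_bdd hbU hFc) (fun k => (hdc k).pow 2) ?_ ?_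
    · intro k x
      rw [abs_pow]
      exact pow_le_pow_left₀ (abs_nonneg _) (hdb k x) 2
    · filter_upwards [ae_restrict_of_ae (fderiv_ae_zero (by omega) hu)] with x hx
      by_cases hux : u x = 0
      · left; simp [hx hux]
      · right
        filter_upwards [deriv_cutoff_eventually hgc hux] with k hk
        simp [δ] at hk ⊢
        simp [hk]
  have T1 : Filter.Tendsto (fun k => ∫ x in U, (u x - δ k * g (u x / δ k)) ^ 2) Filter.atTop
      (nhds (∫ x in U, u x ^ 2)) := by
    refine tendsto_integral_of_dominated_convergence (fun x => (|u x| + M) ^ 2) ?_ ?_ ?_ ?_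
    · intro k
      exact ((hu.continuous.sub (continuous_const.mul (hg.continuous.comp
        (hu.continuous.div_const _)))).pow 2).aestronglyMeasurable
    · exact int_bdd hbU ((hu.continuous.abs.add continuous_const).pow 2)
    · intro k
      refine ae_of_all _ fun x => ?_
      rw [Real.norm_eq_abs, abs_pow]
      refine pow_le_pow_left₀ (abs_nonneg _) ((abs_sub _ _).trans ?_) 2
      have h1 := hgM (u x / δ k)
      have h2 : δ k ≤ 1 := by
        simp only [δ]; rw [div_le_one (by positivity)]
        have : (0 : ℝ) ≤ k := by positivity
        linarith
      rw [abs_mul, abs_of_pos (hδ k)]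
      nlinarith [abs_nonneg (g (u x / δ k)), hδ k]
    · refine ae_of_all _ fun x => ?_
      have hz : Filter.Tendsto (fun k => δ k * g (u x / δ k)) Filter.atTop (nhds 0) := by
        refine squeeze_zero_norm (a := fun k => δ k * M) (fun k => ?_) ?_
        · rw [Real.norm_eq_abs, abs_mul, abs_of_pos (hδ k)]
          exact mul_le_mul_of_nonneg_left (hgM _) (hδ k).le
        · simpa [δ] using (tendsto_one_div_add_atTop_nhds_zero_nat (𝕜 := ℝ)).mul_const M
      simpa using (hz.const_sub (u x)).pow 2
  exact le_of_tendsto_of_tendsto' T1 (T2.const_mul K) ineq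

/-- Orthogonality for test functions. -/
lemma ortho_test (hh : ContDiff ℝ ∞ h) (hharm : IsHarmonicOn h Ω)
    {w : EuclideanSpace ℝ (Fin n) → ℝ} (hw : ContDiff ℝ ∞ w) (hc : HasCompactSupport w)
    (hw0 : ∀ x ∉ Ω, w x = 0) :
    ∫ x, ∑ i, fderiv ℝ w x (EuclideanSpace.single i 1) * fderiv ℝ h x (EuclideanSpace.single i 1) = 0 := by
  have hcd : ∀ v, HasCompactSupport (fun x => fderiv ℝ w x v) := fun v =>
    (hc.fderiv (𝕜 := ℝ)).comp_left (g := fun L : EuclideanSpace ℝ (Fin n) →L[ℝ] ℝ => L v) (by simp)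
  have I1 : ∀ i : Fin n, Integrable (fun x => fderiv ℝ w x (EuclideanSpace.single i 1) *
      fderiv ℝ h x (EuclideanSpace.single i 1)) := fun i =>
    ((cont_d hw _).mul (cont_d hh _)).integrable_of_hasCompactSupport (hcd _).mul_right
  have I2 : ∀ i : Fin n, Integrable (fun x => w x *
      fderiv ℝ (fun y => fderiv ℝ h y (EuclideanSpace.single i 1)) x (EuclideanSpace.single i 1)) := fun i =>
    (hw.continuous.mul (cont_d (contDiff_d hh _) _)).integrable_of_hasCompactSupport hc.mul_right
  have I3 : ∀ i : Fin n, Integrable (fun x => w x * fderiv ℝ h x (EuclideanSpace.single i 1)) := fun i =>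
    (hw.continuous.mul (cont_d hh _)).integrable_of_hasCompactSupport hc.mul_right
  rw [integral_finsetSum _ fun i _ => I1 i]
  have P : ∀ i : Fin n, ∫ x, fderiv ℝ w x (EuclideanSpace.single i 1) * fderiv ℝ h x (EuclideanSpace.single i 1) =
      - ∫ x, w x * fderiv ℝ (fun y => fderiv ℝ h y (EuclideanSpace.single i 1)) x (EuclideanSpace.single i 1) := by
    intro i
    rw [integral_mul_fderiv_eq_neg_fderiv_mul_of_integrable (I1 i) (I2 i) (I3 i)
      (fun x _ => (hw.differentiable (by simp)) x)
      (fun x _ => ((contDiff_d hh _).differentiable (by simp)) x), neg_neg]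
  simp_rw [P]
  rw [Finset.sum_neg_distrib, ← integral_finsetSum _ fun i _ => I2 i, neg_eq_zero]
  simp_rw [← Finset.mul_sum]
  convert integral_zero (EuclideanSpace ℝ (Fin n)) ℝ with x
  by_cases hx : x ∈ Ω
  · simp [hharm x hx]
  · simp [hw0 x hx]

lemma ortho_dirichlet (hn : 2 ≤ n) (hb : Bornology.IsBounded Ω)
    (hu : ContDiff ℝ ∞ u) (h0 : ∀ x ∈ frontier Ω, u x = 0)
    (hh : ContDiff ℝ ∞ h) (hharm : IsHarmonicOn h Ω) :
    ∫ x in interior Ω, ∑ i, fderiv ℝ u x (EuclideanSpace.single i 1) *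
      fderiv ℝ h x (EuclideanSpace.single i 1) = 0 := by
  obtain ⟨g, M, hg, hgc, hg1, hM, hgM, hgM'⟩ := exists_cutoff
  have hbU : Bornology.IsBounded (interior Ω) := hb.subset interior_subset
  have hmU : MeasurableSet (interior Ω) := isOpen_interior.measurableSet
  set U := interior Ω with hUdef
  let δ : ℕ → ℝ := fun k => 1 / ((k : ℝ) + 1)
  have hδ : ∀ k, 0 < δ k := fun k => by positivity
  have hFc : Continuous (fun x => ∑ i, fderiv ℝ u x (EuclideanSpace.single i 1) *
      fderiv ℝ h x (EuclideanSpace.single i 1)) :=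
    continuous_finsetSum _ fun i _ => (cont_d hu _).mul (cont_d hh _)
  have hdc : ∀ k, Continuous fun x => 1 - deriv g (u x / δ k) := fun k =>
    continuous_const.sub ((hg.continuous_deriv (by simp)).comp (hu.continuous.div_const _))
  have hdb : ∀ k x, |1 - deriv g (u x / δ k)| ≤ 1 + M := fun k x =>
    (abs_sub _ _).trans (by have := hgM' (u x / δ k); simpa using this)
  have eqn : ∀ k, ∫ x in U, (1 - deriv g (u x / δ k)) * ∑ i, fderiv ℝ u x (EuclideanSpace.single i 1) *
      fderiv ℝ h x (EuclideanSpace.single i 1) = 0 := by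
    intro k
    have hwc := wk_contDiff hg hg1 hu h0 (hδ k)
    rw [← ortho_test hh hharm hwc (wk_compact hb)
      (fun x hx => indicator_of_notMem (fun h => hx (interior_subset h)) _)]
    rw [← integral_indicator hmU]
    congr 1; ext x
    simp_rw [wk_fderiv hg hg1 hu h0 (hδ k)]
    by_cases hx : x ∈ U <;> simp [hx, ← hUdef, mul_assoc, Finset.mul_sum]
  have T2 : Filter.Tendsto (fun k => ∫ x in U, (1 - deriv g (u x / δ k)) *
      ∑ i, fderiv ℝ u x (EuclideanSpace.single i 1) *
      fderiv ℝ h x (EuclideanSpace.single i 1)) Filter.atTop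
      (nhds (∫ x in U, ∑ i, fderiv ℝ u x (EuclideanSpace.single i 1) *
      fderiv ℝ h x (EuclideanSpace.single i 1))) := by
    refine tendsto_coef (B := (1 + M)) (int_bdd hbU hFc) hdc hdb ?_
    filter_upwards [ae_restrict_of_ae (fderiv_ae_zero (by omega) hu)] with x hx
    by_cases hux : u x = 0
    · left; simp [hx hux]
    · right
      filter_upwards [deriv_cutoff_eventually hgc hux] with k hk
      simp [δ] at hk ⊢
      simp [hk]
  simp_rw [eqn] at T2
  exact tendsto_nhds_unique T2 tendsto_const_nhds

end

section
variable {n : ℕ} {Ω : Set (EuclideanSpace ℝ (Fin n))}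

lemma grad_sq (f : EuclideanSpace ℝ (Fin n) → ℝ) (x : EuclideanSpace ℝ (Fin n)) :
    ‖gradient f x‖ ^ 2 = ∑ i, (fderiv ℝ f x (EuclideanSpace.single i 1)) ^ 2 := by
  rw [EuclideanSpace.real_norm_sq_eq]
  refine Finset.sum_congr rfl fun i _ => ?_
  rw [← inner_gradient_left, EuclideanSpace.inner_single_right]
  simp

lemma var_eq {μ : Measure (EuclideanSpace ℝ (Fin n))} [IsProbabilityMeasure μ]
    {F : EuclideanSpace ℝ (Fin n) → ℝ} (h1 : Integrable F μ) (h2 : Integrable (fun x => F x ^ 2) μ) :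
    var' μ F = ∫ x, (F x - ∫ y, F y ∂μ) ^ 2 ∂μ := by
  set m := ∫ y, F y ∂μ with hm
  have : ∀ x, (F x - m) ^ 2 = F x ^ 2 - 2 * m * F x + m ^ 2 := fun x => by ring
  simp_rw [this]
  have j : Integrable (fun x => F x ^ 2 - 2 * m * F x) μ := h2.sub (h1.const_mul _)
  rw [integral_add j (integrable_const _), integral_sub h2 (h1.const_mul _), integral_const_mul]
  simp [var', ← hm]
  ring

lemma var_add_le {μ : Measure (EuclideanSpace ℝ (Fin n))} [IsProbabilityMeasure μ]
    (hμ : ∀ F : EuclideanSpace ℝ (Fin n) → ℝ, Continuous F → Integrable F μ)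
    {u h : EuclideanSpace ℝ (Fin n) → ℝ} (hu : Continuous u) (hh : Continuous h) :
    var' μ (fun x => u x + h x) ≤ 2 * var' μ u + 2 * var' μ h := by
  have hnn : 0 ≤ var' μ (fun x => u x - h x) := by
    rw [var_eq (F := fun x => u x - h x) (hμ _ (hu.sub hh)) (hμ _ ((hu.sub hh).pow 2))]
    exact integral_nonneg fun x => sq_nonneg _
  have iu := hμ _ hu
  have ih := hμ _ hh
  have iu2 : Integrable (fun x => u x ^ 2) μ := hμ _ (hu.pow 2)
  have ih2 : Integrable (fun x => h x ^ 2) μ := hμ _ (hh.pow 2)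
  have iuh : Integrable (fun x => u x * h x) μ := hμ _ (hu.mul hh)
  have ea : ∀ x, (u x + h x) ^ 2 = u x ^ 2 + h x ^ 2 + 2 * (u x * h x) := fun x => by ring
  have es : ∀ x, (u x - h x) ^ 2 = u x ^ 2 + h x ^ 2 - 2 * (u x * h x) := fun x => by ring
  have j : Integrable (fun x => u x ^ 2 + h x ^ 2) μ := iu2.add ih2
  unfold var' at *
  simp_rw [es] at hnn
  simp_rw [ea]
  rw [integral_sub j (iuh.const_mul _), integral_add iu2 ih2, integral_sub iu ih, integral_const_mul] at hnn
  rw [integral_add j (iuh.const_mul _), integral_add iu2 ih2, integral_add iu ih, integral_const_mul]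
  nlinarith

lemma PH_lower (hn : 2 ≤ n) {V : ℝ} (hV : 0 < V) {U : Set (EuclideanSpace ℝ (Fin n))}
    {μ : Measure (EuclideanSpace ℝ (Fin n))} [IsProbabilityMeasure μ]
    (hμ : ∀ F : EuclideanSpace ℝ (Fin n) → ℝ, Continuous F → Integrable F μ)
    (hI : ∀ F : EuclideanSpace ℝ (Fin n) → ℝ, ∫ x, F x ∂μ = V⁻¹ * ∫ x in U, F x)
    {PH : ℝ} (hPH : ∀ i : Fin n, var' μ (fun x => x i) ≤ PH) :
    V ^ ((2 : ℝ) / n) / (8 * Real.pi * Real.exp 1) ≤ PH := by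
  have hc : ∀ i : Fin n, Continuous (fun x : EuclideanSpace ℝ (Fin n) => x i) := fun i => by fun_prop
  let b : EuclideanSpace ℝ (Fin n) := WithLp.toLp 2 (fun i => ∫ x, x i ∂μ)
  have hb : ∀ i, b i = ∫ x, x i ∂μ := fun i => rfl
  have hnp : (0 : ℝ) < n := by positivity
  have S1 : ∫ x, ‖x - b‖ ^ 2 ∂μ ≤ n * PH := by
    have e : ∀ x : EuclideanSpace ℝ (Fin n), ‖x - b‖ ^ 2 = ∑ i, (x i - b i) ^ 2 := fun x => by
      rw [EuclideanSpace.real_norm_sq_eq]; simp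
    simp_rw [e]
    have hi : ∀ i : Fin n, Integrable (fun x : EuclideanSpace ℝ (Fin n) => (x i - b i) ^ 2) μ :=
      fun i => hμ _ (((hc i).sub continuous_const).pow 2)
    rw [integral_finsetSum _ fun i _ => hi i]
    calc ∑ i, ∫ x, (x i - b i) ^ 2 ∂μ ≤ ∑ i : Fin n, PH := by
          refine Finset.sum_le_sum fun i _ => ?_
          rw [hb, ← var_eq (hμ _ (hc i)) (hμ _ ((hc i).pow 2))]
          exact hPH i
      _ = n * PH := by simp
  have hq : 0 < V⁻¹ := by positivity
  set t := tq n V⁻¹ with ht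
  have htp : 0 < t := tq_pos hq
  have gi : Integrable (fun x : EuclideanSpace ℝ (Fin n) => Real.exp (n / 2 - t * ‖x - b‖ ^ 2)) :=
    (gauss_int hq).comp_sub_right b
  have ge : ∫ x : EuclideanSpace ℝ (Fin n), Real.exp (n / 2 - t * ‖x - b‖ ^ 2) = V / 2 := by
    rw [integral_sub_right_eq_self (fun x : EuclideanSpace ℝ (Fin n) => Real.exp (n / 2 - t * ‖x‖ ^ 2)) b,
      gauss_mass (by omega) hq]
    field_simp
  have c1 : Continuous (fun x : EuclideanSpace ℝ (Fin n) => Real.exp (n / 2 - t * ‖x - b‖ ^ 2)) := by fun_prop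
  have c2 : Continuous (fun x : EuclideanSpace ℝ (Fin n) => ‖x - b‖ ^ 2) := by fun_prop
  have S2 : 1 ≤ 1 / 2 + t / (n / 2) * ∫ x, ‖x - b‖ ^ 2 ∂μ := by
    calc (1 : ℝ) = ∫ x, (1 : ℝ) ∂μ := by simp
      _ ≤ ∫ x, (Real.exp (n / 2 - t * ‖x - b‖ ^ 2) + t / (n / 2) * ‖x - b‖ ^ 2) ∂μ := by
          refine integral_mono (integrable_const _) ((hμ _ c1).add ((hμ _ c2).const_mul _)) fun x => ?_
          have h := one_le_exp_add (a := (n : ℝ) / 2) (s := t * ‖x - b‖ ^ 2) (by positivity) (by positivity)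
          have e : t * ‖x - b‖ ^ 2 / (n / 2) = t / (n / 2) * ‖x - b‖ ^ 2 := by
            field_simp
          rw [e] at h
          exact h
      _ = ∫ x, Real.exp (n / 2 - t * ‖x - b‖ ^ 2) ∂μ + t / (n / 2) * ∫ x, ‖x - b‖ ^ 2 ∂μ := by
          rw [integral_add (hμ _ c1) ((hμ _ c2).const_mul _), integral_const_mul]
      _ ≤ _ := by
          gcongr
          rw [hI]
          calc V⁻¹ * ∫ x in U, Real.exp (n / 2 - t * ‖x - b‖ ^ 2)
              ≤ V⁻¹ * ∫ x, Real.exp (n / 2 - t * ‖x - b‖ ^ 2) := by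
                gcongr ?_ * ?_
                exact setIntegral_le_integral gi (ae_of_all _ fun x => (Real.exp_pos _).le)
            _ = 1 / 2 := by rw [ge]; field_simp
  have htle := tq_le hn hq
  rw [← ht, Real.inv_rpow hV.le] at htle
  set v := V ^ ((2 : ℝ) / n) with hv
  have hvp : 0 < v := by positivity
  have S3 : 1 / 2 ≤ 2 * t * PH := by
    have : t / (n / 2) * ∫ x, ‖x - b‖ ^ 2 ∂μ ≤ t / (n / 2) * (n * PH) := by gcongr
    have e : t / (n / 2) * (n * PH) = 2 * t * PH := by field_simp
    linarith
  have hp := Real.pi_pos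
  have he := Real.exp_pos 1
  have hPH0 : 0 < PH := by
    by_contra hcon
    push Not at hcon
    nlinarith
  have S4 : 1 / 2 ≤ 2 * (2 * Real.pi * Real.exp 1 * v⁻¹) * PH := by
    refine S3.trans ?_
    gcongr
  rw [div_le_iff₀ (by positivity)]
  have : 2 * (2 * Real.pi * Real.exp 1 * v⁻¹) * PH = (PH * (8 * Real.pi * Real.exp 1)) / (2 * v) := by
    field_simp; ring
  rw [this, le_div_iff₀ (by positivity)] at S4
  linarith

lemma coord_fderiv (i : Fin n) (x v : EuclideanSpace ℝ (Fin n)) :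
    fderiv ℝ (fun y : EuclideanSpace ℝ (Fin n) => y i) x v = v i := by
  have : HasFDerivAt (fun y : EuclideanSpace ℝ (Fin n) => y i)
      (EuclideanSpace.proj i : EuclideanSpace ℝ (Fin n) →L[ℝ] ℝ) x :=
    (EuclideanSpace.proj i : EuclideanSpace ℝ (Fin n) →L[ℝ] ℝ).hasFDerivAt
  rw [this.fderiv]; simp

end

end HelperSection

/-- reduction of the KLS conjecture to harmonic functions. There are
universal constants `C₁, C > 0` such that for every bounded convex domain `Ω ⊂ ℝⁿ`, if
every smooth `f` admits a harmonic `h` agreeing with it on `∂Ω` (so `f = (f-h) + h`), and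
`PH` is a Poincaré constant for harmonic functions on `Ω`, then
`Var_{λ_Ω}(f) ≤ max(C₁|Ω|^{2/n}/n, 2 PH) ∫ |∇f|² dλ_Ω`; in particular `P^N_Ω ≤ C · PH`. -/
theorem stmt_10 :
    ∃ C₁ C : ℝ, 0 < C₁ ∧ 0 < C ∧
      ∀ (n : ℕ), 2 ≤ n → ∀ Ω : Set (EuclideanSpace ℝ (Fin n)),
        Convex ℝ Ω → Bornology.IsBounded Ω → (interior Ω).Nonempty →
        ∀ PH : ℝ, 0 ≤ PH →
        (∀ h : EuclideanSpace ℝ (Fin n) → ℝ, ContDiff ℝ (⊤ : ℕ∞) h → IsHarmonicOn h Ω →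
          var' ((volume Ω)⁻¹ • volume.restrict Ω) h ≤
            PH * ∫ x, ‖gradient h x‖ ^ 2 ∂((volume Ω)⁻¹ • volume.restrict Ω)) →
        (∀ f : EuclideanSpace ℝ (Fin n) → ℝ, ContDiff ℝ (⊤ : ℕ∞) f →
          ∃ h : EuclideanSpace ℝ (Fin n) → ℝ, ContDiff ℝ (⊤ : ℕ∞) h ∧ IsHarmonicOn h Ω ∧
            EqOn h f (frontier Ω)) →
        ∀ f : EuclideanSpace ℝ (Fin n) → ℝ, ContDiff ℝ (⊤ : ℕ∞) f →
          var' ((volume Ω)⁻¹ • volume.restrict Ω) f ≤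
              max (C₁ * (volume Ω).toReal ^ ((2 : ℝ) / n) / n) (2 * PH) *
                ∫ x, ‖gradient f x‖ ^ 2 ∂((volume Ω)⁻¹ • volume.restrict Ω) ∧
            var' ((volume Ω)⁻¹ • volume.restrict Ω) f ≤
              C * PH * ∫ x, ‖gradient f x‖ ^ 2 ∂((volume Ω)⁻¹ • volume.restrict Ω) := by
  refine ⟨4 * Real.exp 1 / Real.pi, 16 * Real.exp 1 ^ 2, by positivity, by positivity, ?_⟩
  intro n hn Ω hconv hb hne PH hPH0 hPH hdir f hf
  have hfr : volume (frontier Ω) = 0 := hconv.addHaar_frontier volume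
  have hae : (interior Ω : Set (EuclideanSpace ℝ (Fin n))) =ᵐ[volume] Ω :=
    interior_ae_eq_of_null_frontier hfr
  have hvol : volume (interior Ω) = volume Ω := measure_congr hae
  have hres : volume.restrict (interior Ω) = volume.restrict Ω := Measure.restrict_congr_set hae
  have hpos : 0 < volume Ω := hvol ▸ isOpen_interior.measure_pos volume hne
  have hfin : volume Ω < ⊤ := hb.measure_lt_top
  set V := (volume Ω).toReal with hVdef
  have hV : 0 < V := ENNReal.toReal_pos hpos.ne' hfin.ne
  set μ := (volume Ω)⁻¹ • volume.restrict Ω with hμdef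
  have hI : ∀ F : EuclideanSpace ℝ (Fin n) → ℝ, ∫ x, F x ∂μ = V⁻¹ * ∫ x in interior Ω, F x := by
    intro F
    rw [hμdef, integral_smul_measure, hres, ENNReal.toReal_inv, smul_eq_mul]
  have hprob : IsProbabilityMeasure μ := ⟨by
    simp [hμdef, ENNReal.inv_mul_cancel hpos.ne' hfin.ne]⟩
  have hμ : ∀ F : EuclideanSpace ℝ (Fin n) → ℝ, Continuous F → Integrable F μ := fun F hF =>
    (int_bdd hb hF).smul_measure (ENNReal.inv_ne_top.2 hpos.ne')
  obtain ⟨h, hh, hharm, hbd⟩ := hdir f hf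
  let u : EuclideanSpace ℝ (Fin n) → ℝ := fun x => f x - h x
  have hu : ContDiff ℝ (⊤ : ℕ∞) u := hf.sub hh
  have hu0 : ∀ x ∈ frontier Ω, u x = 0 := fun x hx => by simp [u, hbd hx]
  -- Dirichlet part
  have hK := fk_dirichlet hn hb hu hu0 (by rw [hvol]; exact hV)
  rw [hvol, ← hVdef] at hK
  set K := (2 * Real.exp 1 / Real.pi) * V ^ ((2 : ℝ) / n) / n with hKdef
  have hp := Real.pi_pos
  have hnp : (2 : ℝ) ≤ n := by exact_mod_cast hn
  have hK0 : 0 ≤ K := by positivity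
  have hor := ortho_dirichlet hn hb hu hu0 hh hharm
  have hcs : ∀ w : EuclideanSpace ℝ (Fin n) → ℝ, ContDiff ℝ (⊤ : ℕ∞) w →
      Continuous (fun x => ∑ i, (fderiv ℝ w x (EuclideanSpace.single i 1)) ^ 2) := fun w hw =>
    continuous_finsetSum _ fun i _ => (cont_d hw _).pow 2
  simp_rw [grad_sq] at hPH ⊢
  set Du := ∫ x, ∑ i, (fderiv ℝ u x (EuclideanSpace.single i 1)) ^ 2 ∂μ with hDu
  set Dh := ∫ x, ∑ i, (fderiv ℝ h x (EuclideanSpace.single i 1)) ^ 2 ∂μ with hDh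
  set Df := ∫ x, ∑ i, (fderiv ℝ f x (EuclideanSpace.single i 1)) ^ 2 ∂μ with hDf
  have hDu0 : 0 ≤ Du := integral_nonneg fun x => Finset.sum_nonneg fun i _ => sq_nonneg _
  have hDh0 : 0 ≤ Dh := integral_nonneg fun x => Finset.sum_nonneg fun i _ => sq_nonneg _
  have hpyth : Df = Du + Dh := by
    have hcr : Continuous (fun x => ∑ i, fderiv ℝ u x (EuclideanSpace.single i 1) *
      fderiv ℝ h x (EuclideanSpace.single i 1)) :=
      continuous_finsetSum _ fun i _ => (cont_d hu _).mul (cont_d hh _)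
    have e : ∀ x, ∑ i, (fderiv ℝ f x (EuclideanSpace.single i 1)) ^ 2 =
        (∑ i, (fderiv ℝ u x (EuclideanSpace.single i 1)) ^ 2 +
        ∑ i, (fderiv ℝ h x (EuclideanSpace.single i 1)) ^ 2) +
        2 * ∑ i, fderiv ℝ u x (EuclideanSpace.single i 1) *
          fderiv ℝ h x (EuclideanSpace.single i 1) := by
      intro x
      rw [Finset.mul_sum, ← Finset.sum_add_distrib, ← Finset.sum_add_distrib]
      refine Finset.sum_congr rfl fun i _ => ?_
      have : fderiv ℝ u x = fderiv ℝ f x - fderiv ℝ h x :=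
        fderiv_fun_sub ((hf.differentiable (by simp)) x) ((hh.differentiable (by simp)) x)
      rw [this, sub_apply]
      ring
    have hz : ∫ x, ∑ i, fderiv ℝ u x (EuclideanSpace.single i 1) *
          fderiv ℝ h x (EuclideanSpace.single i 1) ∂μ = 0 := by
      rw [hI, hor, mul_zero]
    rw [hDf]
    simp_rw [e]
    have hsum : Integrable (fun x => ∑ i, (fderiv ℝ u x (EuclideanSpace.single i 1)) ^ 2 +
        ∑ i, (fderiv ℝ h x (EuclideanSpace.single i 1)) ^ 2) μ :=
      hμ _ ((hcs u hu).add (hcs h hh))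
    rw [integral_add hsum ((hμ _ hcr).const_mul _),
      integral_add (hμ _ (hcs u hu)) (hμ _ (hcs h hh)), integral_const_mul, hz]
    ring
  have hvu : var' μ u ≤ K * Du := by
    have h1 : var' μ u ≤ ∫ x, u x ^ 2 ∂μ := by
      unfold var'
      have := sq_nonneg (∫ x, u x ∂μ)
      linarith
    refine h1.trans ?_
    rw [hDu, hI, hI]
    have : V⁻¹ * ∫ x in interior Ω, u x ^ 2 ≤ V⁻¹ * (K * ∫ x in interior Ω,
        ∑ i, (fderiv ℝ u x (EuclideanSpace.single i 1)) ^ 2) := by gcongr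
    linarith
  have hvh : var' μ h ≤ PH * Dh := hPH h hh hharm
  have hvf : var' μ f ≤ 2 * (K * Du) + 2 * (PH * Dh) := by
    have h1 := var_add_le hμ hu.continuous hh.continuous
    have h2 : (fun x => u x + h x) = f := by ext x; simp [u]
    rw [h2] at h1
    linarith
  -- linear functions
  have hlow : V ^ ((2 : ℝ) / n) / (8 * Real.pi * Real.exp 1) ≤ PH := by
    refine PH_lower hn hV hμ hI fun i => ?_
    have := hPH (fun x => x i) (by fun_prop) (by
      intro x _
      refine Finset.sum_eq_zero fun j _ => ?_
      simp_rw [coord_fderiv]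
      simp)
    simp_rw [coord_fderiv] at this
    simpa [Pi.single_apply] using this
  have hmain : ∀ A : ℝ, 2 * K ≤ A → 2 * PH ≤ A → var' μ f ≤ A * Df := by
    intro A h1 h2
    rw [hpyth]
    nlinarith [mul_le_mul_of_nonneg_right h1 hDu0, mul_le_mul_of_nonneg_right h2 hDh0]
  refine ⟨hmain _ (le_max_of_le_left (le_of_eq ?_)) (le_max_right _ _), hmain _ ?_ ?_⟩
  · rw [hKdef]; ring
  · have he := Real.exp_pos 1
    rw [div_le_iff₀ (by positivity)] at hlow
    rw [hKdef]
    calc 2 * (2 * Real.exp 1 / Real.pi * V ^ ((2 : ℝ) / n) / n)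
        ≤ 2 * (2 * Real.exp 1 / Real.pi * (PH * (8 * Real.pi * Real.exp 1)) / 2) := by gcongr
      _ = 16 * Real.exp 1 ^ 2 * PH := by field_simp; ring
  · have : 1 ≤ Real.exp 1 := Real.one_le_exp (by norm_num)
    have : 1 ≤ Real.exp 1 ^ 2 := one_le_pow₀ this
    gcongr
    linarith
end

section
/- Let μ be a probability measure on ℝⁿ (n ≥ 3) with upper-semicontinuous log-concave density f, barycenter at the origin, and associated Ball body K_μ defined by 1/‖x‖_{K_μ} = (n ∫₀^∞ r^{n−1} f(rx) dr)^{1/n}. If K_μ ⊃ R·B₂ⁿ and T(x) = x/‖x‖_{K_μ}, then ∫_{ℝⁿ} ‖dT*(x)‖²_op dμ(x) ≤ C·(f(0)^{2/n}/R²)·∫_{K_μ} |x|² dx for a universal constant C. -/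
open MeasureTheory Metric Set
open scoped RealInnerProductSpace ENNReal

/-- Weak Fradelizi bound. -/
lemma frad {n : ℕ} (f : EuclideanSpace ℝ (Fin n) → ℝ)
    (h0 : ∀ x, 0 ≤ f x) (husc : UpperSemicontinuous f) (hint : Integrable f) (h1 : ∫ x, f x = 1)
    (hlc : ∀ x y : EuclideanSpace ℝ (Fin n), ∀ t ∈ Icc (0 : ℝ) 1,
          f x ^ t * f y ^ (1 - t) ≤ f (t • x + (1 - t) • y))
    (hbi : Integrable fun x => f x • x)
    (hb : ∫ x, f x • x = (0 : EuclideanSpace ℝ (Fin n))) :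
    0 < f 0 ∧ ∀ y, f y ≤ 4 ^ n * f 0 := by
  have hmeas : Measurable f := husc.measurable
  have hmid : ∀ y x, √(f y) * √(f x) ≤ f ((1/2 : ℝ) • y + (1/2 : ℝ) • x) := by
    intro y x
    have := hlc y x (1/2) ⟨by norm_num, by norm_num⟩
    rw [Real.sqrt_eq_rpow, Real.sqrt_eq_rpow]
    norm_num at this ⊢
    exact this
  have hIy : ∀ y, Integrable (fun x => f ((1/2 : ℝ) • y + (1/2 : ℝ) • x)) := by
    intro y
    exact (hint.comp_add_left ((1/2 : ℝ) • y)).comp_smul (by norm_num : (1/2 : ℝ) ≠ 0)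
  have hIv : ∀ y, ∫ x, f ((1/2 : ℝ) • y + (1/2 : ℝ) • x) = 2 ^ n := by
    intro y
    have := Measure.integral_comp_smul volume (fun x => f ((1/2 : ℝ) • y + x)) (1/2 : ℝ)
    rw [this, integral_add_left_eq_self, h1]
    simp
  obtain ⟨y0, hy0⟩ : ∃ y, 0 < f y := by
    by_contra! h
    have : f = 0 := funext fun x => le_antisymm (h x) (h0 x)
    simp [this] at h1
  have hs : Integrable (fun x => √(f x)) := by
    refine ((hIy y0).const_mul (√(f y0))⁻¹).mono' (by fun_prop) (.of_forall fun x => ?_)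
    rw [Real.norm_of_nonneg (Real.sqrt_nonneg _), ← div_eq_inv_mul,
      le_div_iff₀ (Real.sqrt_pos.2 hy0), mul_comm]
    exact hmid y0 x
  set I := ∫ x, √(f x) with hI
  have hI0 : 0 ≤ I := integral_nonneg fun x => Real.sqrt_nonneg _
  have hyI : ∀ y, √(f y) * I ≤ 2 ^ n := by
    intro y
    rw [← hIv y, hI, ← integral_const_mul]
    exact integral_mono (hs.const_mul _) (hIy y) (hmid y)
  have hIpos : 0 < I := by
    refine lt_of_le_of_ne hI0 fun h => ?_
    rw [hI, eq_comm, integral_eq_zero_iff_of_nonneg (fun x => Real.sqrt_nonneg _) hs] at h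
    have : f =ᵐ[volume] 0 := by
      filter_upwards [h] with x hx
      exact (Real.sqrt_eq_zero (h0 x)).1 hx
    rw [integral_congr_ae this] at h1
    simp at h1
  have hfM : ∀ y, √(f y) ≤ 2 ^ n / I := fun y => by
    rw [le_div_iff₀ hIpos]; exact hyI y
  set s0 : ℝ := I / 2 ^ n with hs0
  have hs0p : 0 < s0 := by positivity
  -- epigraph
  let E : Set (EuclideanSpace ℝ (Fin n) × ℝ) := {p | s0 ≤ p.2 ∧ 1 / (max p.2 s0) ^ 2 ≤ f p.1}
  have hEmem : ∀ p, p ∈ E ↔ s0 ≤ p.2 ∧ 1 / p.2 ^ 2 ≤ f p.1 := by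
    intro p
    constructor
    · rintro ⟨a, b⟩; rw [max_eq_left a] at b; exact ⟨a, b⟩
    · rintro ⟨a, b⟩; refine ⟨a, ?_⟩; rw [max_eq_left a]; exact b
  have hEc : IsClosed E := by
    have hh : IsClosed {p : EuclideanSpace ℝ (Fin n) × ℝ | p.2 ≤ f p.1} := by
      have := (upperSemicontinuousOn_iff_isClosed_hypograph (f := f) isClosed_univ).1
        (husc.upperSemicontinuousOn _)
      simpa using this
    have hc : Continuous (fun p : EuclideanSpace ℝ (Fin n) × ℝ => (p.1, 1 / (max p.2 s0) ^ 2)) := by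
      refine continuous_fst.prodMk (Continuous.div continuous_const (by fun_prop) fun p => ?_)
      have : 0 < max p.2 s0 := lt_max_of_lt_right hs0p
      positivity
    exact (isClosed_le continuous_const continuous_snd).inter (hh.preimage hc)
  have hEx : Convex ℝ E := by
    rintro ⟨x, s⟩ hp ⟨y, t⟩ hq a b ha hb hab
    rw [hEmem] at hp hq ⊢
    obtain ⟨hp1, hp2⟩ := hp
    obtain ⟨hq1, hq2⟩ := hq
    simp only [Prod.smul_mk, Prod.mk_add_mk, smul_eq_mul] at *
    have hsp : 0 < s := hs0p.trans_le hp1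
    have htp : 0 < t := hs0p.trans_le hq1
    obtain rfl : b = 1 - a := by linarith
    refine ⟨by nlinarith, ?_⟩
    have h3 := Real.geom_mean_le_arith_mean2_weighted ha hb hsp.le htp.le hab
    have h4 := hlc x y a ⟨ha, by linarith⟩
    refine le_trans ?_ h4
    have h5 : (1 / s ^ 2) ^ a * (1 / t ^ 2) ^ (1 - a) ≤ f x ^ a * f y ^ (1 - a) := by
      have := Real.rpow_nonneg (h0 x) a
      gcongr
    refine le_trans ?_ h5
    have h6 : (1 / s ^ 2) ^ a * (1 / t ^ 2) ^ (1 - a) = 1 / (s ^ a * t ^ (1 - a)) ^ 2 := by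
      rw [Real.div_rpow zero_le_one (by positivity), Real.div_rpow zero_le_one (by positivity),
        ← Real.rpow_pow_comm hsp.le, ← Real.rpow_pow_comm htp.le]
      simp only [Real.one_rpow]
      rw [div_mul_div_comm, one_mul, mul_pow]
    rw [h6]
    have : 0 < s ^ a * t ^ (1 - a) := by positivity
    gcongr
  let μ : Measure (EuclideanSpace ℝ (Fin n)) := volume.withDensity fun x => ENNReal.ofReal (f x)
  have hofm : Measurable fun x => ENNReal.ofReal (f x) := hmeas.ennreal_ofReal
  have hμ : IsProbabilityMeasure μ := by
    constructor
    rw [withDensity_apply _ MeasurableSet.univ, Measure.restrict_univ,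
      ← ofReal_integral_eq_lintegral_ofReal hint (.of_forall h0), h1, ENNReal.ofReal_one]
  have hsq : (fun x => f x * (√(f x))⁻¹) = fun x => √(f x) := by
    ext x
    rw [← div_eq_mul_inv, Real.div_sqrt]
  have hx : Integrable (fun x => x) μ := by
    rw [integrable_withDensity_iff_integrable_smul' hofm (by simp)]
    simpa [ENNReal.toReal_ofReal (h0 _)] using hbi
  have hg : Integrable (fun x => (√(f x))⁻¹) μ := by
    rw [integrable_withDensity_iff_integrable_smul' hofm (by simp)]
    simpa only [ENNReal.toReal_ofReal (h0 _), smul_eq_mul, hsq] using hs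
  have hmem := hEx.integral_mem (μ := μ) hEc (f := fun x => (x, (√(f x))⁻¹)) ?_ (hx.prodMk hg)
  · rw [integral_pair hx hg, integral_withDensity_eq_integral_toReal_smul hofm (by simp),
      integral_withDensity_eq_integral_toReal_smul hofm (by simp), hEmem] at hmem
    simp only [ENNReal.toReal_ofReal (h0 _), smul_eq_mul, hsq, hb] at hmem
    rw [← hI] at hmem
    have h2 := hmem.2
    refine ⟨lt_of_lt_of_le (by positivity) h2, fun y => ?_⟩
    rw [div_le_iff₀ (by positivity)] at h2
    have h7 : f y * I ^ 2 ≤ 4 ^ n := by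
      have := pow_le_pow_left₀ (by positivity) (hyI y) 2
      rw [mul_pow, Real.sq_sqrt (h0 y), ← pow_mul, mul_comm n, pow_mul] at this
      norm_num at this
      exact this
    calc f y ≤ f y * (f 0 * I ^ 2) := le_mul_of_one_le_right (h0 y) h2
      _ = (f y * I ^ 2) * f 0 := by ring
      _ ≤ _ := by gcongr; exact h0 0
  · have : ∀ᵐ x ∂μ, ENNReal.ofReal (f x) ≠ 0 := by
      rw [ae_withDensity_iff hofm]
      exact .of_forall fun x h => h
    filter_upwards [this] with x hx
    rw [hEmem]
    have hfx : 0 < f x := by simpa using hx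
    have hsx := Real.sqrt_pos.2 hfx
    constructor
    · rw [hs0, ← inv_div]
      exact inv_anti₀ hsx (hfM x)
    · simp only
      rw [inv_pow, one_div, inv_inv, Real.sq_sqrt (h0 x)]

lemma polar {n : ℕ} (F : EuclideanSpace ℝ (Fin (n+1)) → ℝ≥0∞) (hF : Measurable F) :
    ∫⁻ x, F x = ∫⁻ θ, (∫⁻ r in Ioi (0 : ℝ), ENNReal.ofReal (r ^ n) * F (r • θ.1))
      ∂(volume : Measure (EuclideanSpace ℝ (Fin (n+1)))).toSphere := by
  have h := (volume : Measure (EuclideanSpace ℝ (Fin (n+1)))).measurePreserving_homeomorphUnitSphereProd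
  have h2 := h.lintegral_comp_emb (Homeomorph.measurableEmbedding _) (fun p => F (p.2.1 • p.1.1))
  have h3 : ∫⁻ x, F x = ∫⁻ x : ({(0)}ᶜ : Set (EuclideanSpace ℝ (Fin (n+1)))), F x.1
      ∂((volume : Measure (EuclideanSpace ℝ (Fin (n+1)))).comap (↑)) := by
    rw [lintegral_subtype_comap (measurableSet_singleton _).compl, restrict_compl_singleton]
  have hm : Measurable (fun p : sphere (0 : EuclideanSpace ℝ (Fin (n+1))) 1 × Ioi (0:ℝ) => F (p.2.1 • p.1.1)) := by
    fun_prop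
  rw [h3]
  calc _ = _ := by
        refine lintegral_congr fun x => ?_
        have : x.1 = ((homeomorphUnitSphereProd _ x).2.1 • (homeomorphUnitSphereProd _ x).1.1) := by
          have hx : ‖x.1‖ ≠ 0 := norm_ne_zero_iff.2 x.2
          simp [smul_smul, hx]
        exact congrArg F this
    _ = _ := h2
    _ = _ := by
        rw [lintegral_prod _ hm.aemeasurable]
        refine lintegral_congr fun θ => ?_
        rw [Measure.volumeIoiPow, lintegral_withDensity_eq_lintegral_mul _ (by fun_prop) (by fun_prop)]
        simp only [finrank_euclideanSpace, Fintype.card_fin, Nat.add_sub_cancel]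
        exact lintegral_subtype_comap measurableSet_Ioi
          (fun r : ℝ => ENNReal.ofReal (r ^ n) * F (r • θ.1))

/-- one-dimensional moment comparison -/
lemma moment {N : ℕ} (h : ℝ → ℝ) (c m : ℝ) (hc : 0 < c) (hm : 0 < m)
    (h0 : ∀ r, 0 ≤ h r) (hM : ∀ r, h r ≤ m ^ (N + 3))
    (hi : IntegrableOn (fun r => r ^ (N + 2) * h r) (Ioi 0))
    (hv : ((N : ℝ) + 3) * ∫ r in Ioi (0 : ℝ), r ^ (N + 2) * h r = c ^ (N + 3)) :
    ∫⁻ r in Ioi (0 : ℝ), ENNReal.ofReal (r ^ N * h r) ≤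
      ENNReal.ofReal (m ^ 2 * c ^ (N + 1) / (N + 1)) := by
  set a := c / m with ha
  have hap : 0 < a := by positivity
  have hpi : ∀ k : ℕ, IntegrableOn (fun r : ℝ => r ^ k) (Ioc 0 a) := fun k =>
    (intervalIntegral.intervalIntegrable_pow k).1
  have hpv : ∀ k : ℕ, ∫ r in Ioc 0 a, r ^ k = a ^ (k + 1) / (k + 1) := fun k => by
    rw [← intervalIntegral.integral_of_le hap.le, integral_pow]; simp
  let G1 : ℝ → ℝ := fun r => m ^ (N + 3) * (r ^ N - a⁻¹ ^ 2 * r ^ (N + 2))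
  have hG1 : IntegrableOn G1 (Ioc 0 a) := ((hpi N).sub ((hpi (N+2)).const_mul _)).const_mul _
  have hG1v : ∫ r in Ioc 0 a, G1 r = m ^ (N + 3) * (a ^ (N + 1) / (N + 1) - a⁻¹ ^ 2 * (a ^ (N + 3) / (N + 3))) := by
    simp only [G1]
    rw [integral_const_mul, integral_sub (hpi N) ((hpi (N+2)).const_mul _), integral_const_mul, hpv, hpv]
    push_cast
    ring_nf
  let G : ℝ → ℝ := fun r => a⁻¹ ^ 2 * (r ^ (N + 2) * h r) + (Ioc 0 a).indicator G1 r
  have hG2 : IntegrableOn ((Ioc 0 a).indicator G1) (Ioi 0) :=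
    ((integrable_indicator_iff measurableSet_Ioc).2 hG1).integrableOn
  have hG : IntegrableOn G (Ioi 0) := (hi.const_mul _).add hG2
  have hGv : ∫ r in Ioi 0, G r = m ^ 2 * c ^ (N + 1) / (N + 1) := by
    simp only [G]
    rw [integral_add (hi.const_mul _) hG2, integral_const_mul,
      setIntegral_indicator measurableSet_Ioc, inter_eq_right.2 Ioc_subset_Ioi_self, hG1v]
    have : ∫ r in Ioi (0 : ℝ), r ^ (N + 2) * h r = c ^ (N + 3) / (N + 3) := by
      rw [eq_div_iff (by positivity), mul_comm]; exact hv
    have hca : c = a * m := by rw [ha]; field_simp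
    rw [this, hca]
    clear_value a
    field_simp
    ring
  have key : ∀ r ∈ Ioi (0 : ℝ), r ^ N * h r ≤ G r := by
    intro r hr
    have hr : 0 < r := hr
    have hrN : 0 < r ^ N := by positivity
    have e : r ^ N * h r - a⁻¹ ^ 2 * (r ^ (N + 2) * h r) = (r ^ N * (1 - (r / a) ^ 2)) * h r := by
      rw [div_eq_mul_inv]; ring
    by_cases hra : r ≤ a
    · have hmem : r ∈ Ioc 0 a := ⟨hr, hra⟩
      simp only [G, indicator_of_mem hmem, G1]
      have h2 : 0 ≤ r ^ N * (1 - (r / a) ^ 2) := by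
        have : r / a ≤ 1 := (div_le_one hap).2 hra
        have h3 : (r / a) ^ 2 ≤ 1 := pow_le_one₀ (by positivity) this
        exact mul_nonneg hrN.le (by linarith)
      have h4 := mul_le_mul_of_nonneg_left (hM r) h2
      have e2 : m ^ (N + 3) * (r ^ N - a⁻¹ ^ 2 * r ^ (N + 2)) = r ^ N * (1 - (r / a) ^ 2) * m ^ (N + 3) := by
        rw [div_eq_mul_inv]; ring
      rw [e2]; linarith
    · have hmem : r ∉ Ioc 0 a := fun h => hra h.2
      simp only [G, indicator_of_notMem hmem, add_zero]
      have h2 : r ^ N * (1 - (r / a) ^ 2) ≤ 0 := by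
        have : 1 ≤ r / a := (one_le_div hap).2 (not_le.1 hra).le
        have h3 : 1 ≤ (r / a) ^ 2 := one_le_pow₀ this
        exact mul_nonpos_of_nonneg_of_nonpos hrN.le (by linarith)
      have := mul_nonpos_of_nonpos_of_nonneg h2 (h0 r)
      linarith
  rw [← hGv, ofReal_integral_eq_lintegral_ofReal hG]
  · exact setLIntegral_mono' measurableSet_Ioi fun r hr => ENNReal.ofReal_le_ofReal (key r hr)
  · filter_upwards [ae_restrict_mem measurableSet_Ioi] with r hr
    have hr' : (0:ℝ) < r := hr
    exact le_trans (mul_nonneg (by positivity) (h0 r)) (key r hr)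

lemma radial_fderiv {n : ℕ} (K : Set (EuclideanSpace ℝ (Fin n))) (R : ℝ) (hR : 0 < R)
    (hc : Convex ℝ K) (hball : closedBall (0 : EuclideanSpace ℝ (Fin n)) R ⊆ K)
    (x : EuclideanSpace ℝ (Fin n)) (hx : 0 < gauge K x) :
    ‖fderiv ℝ (fun y => (gauge K y)⁻¹ • y) x‖ ≤ 4 * ‖x‖ / (R * gauge K x ^ 2) := by
  have hb : ball (0 : EuclideanSpace ℝ (Fin n)) R ⊆ K := ball_subset_closedBall.trans hball
  have hlip := hc.lipschitzWith_gauge (r := ⟨R, hR.le⟩) hR hb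
  have hgx : R * gauge K x ≤ ‖x‖ := mul_gauge_le_norm hb
  set g := gauge K x with hg
  refine norm_fderiv_le_of_lip' ℝ (by positivity) ?_
  have hcont : ContinuousAt (gauge K) x := hlip.continuous.continuousAt
  filter_upwards [hcont.eventually (lt_mem_nhds (show g / 2 < gauge K x by rw [← hg]; linarith))] with y hy
  have hgy : 0 < gauge K y := by linarith
  set u := gauge K y with hu
  have hl : |u - g| ≤ R⁻¹ * ‖y - x‖ := by
    have := hlip.dist_le_mul y x
    rw [Real.dist_eq, dist_eq_norm] at this
    exact this
  have e : u⁻¹ • y - g⁻¹ • x = u⁻¹ • (y - x) + ((g - u) * (u⁻¹ * g⁻¹)) • x := by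
    have : (g - u) * (u⁻¹ * g⁻¹) = u⁻¹ - g⁻¹ := by field_simp
    rw [this, smul_sub, sub_smul]; abel
  rw [e]
  refine (norm_add_le _ _).trans ?_
  rw [norm_smul, norm_smul, Real.norm_eq_abs, Real.norm_eq_abs, abs_of_pos (inv_pos.2 hgy), abs_mul,
    abs_of_pos (show 0 < u⁻¹ * g⁻¹ by positivity), abs_sub_comm g u]
  have hui : u⁻¹ ≤ 2 / g := by
    rw [← inv_div]; exact inv_anti₀ (by positivity) hy.le
  have h1 : 2 / g ≤ 2 * ‖x‖ / (R * g ^ 2) := by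
    rw [div_le_div_iff₀ hx (by positivity)]
    nlinarith
  calc u⁻¹ * ‖y - x‖ + |u - g| * (u⁻¹ * g⁻¹) * ‖x‖
      ≤ (2 * ‖x‖ / (R * g ^ 2)) * ‖y - x‖ + (R⁻¹ * ‖y - x‖) * (2 / g * g⁻¹) * ‖x‖ := by
        gcongr
        exact hui.trans h1
    _ = _ := by field_simp; ring

lemma main_lintegral {N : ℕ} (f : EuclideanSpace ℝ (Fin (N + 3)) → ℝ)
    (K : Set (EuclideanSpace ℝ (Fin (N + 3)))) (m : ℝ) (hm : 0 < m)
    (h0 : ∀ x, 0 ≤ f x) (hmeas : Measurable f) (hM : ∀ x, f x ≤ m ^ (N + 3))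
    (hcv : Convex ℝ K) (hK : IsCompact K) (hK0 : K ∈ nhds 0)
    (hgp : ∀ x, x ≠ 0 → 0 < gauge K x)
    (hg : ∀ x : EuclideanSpace ℝ (Fin (N + 3)), x ≠ 0 → (gauge K x)⁻¹ =
          (((N + 3 : ℕ) : ℝ) * ∫ r in Ioi (0 : ℝ), r ^ (((N + 3 : ℕ) : ℝ) - 1) * f (r • x)) ^
            ((1 : ℝ) / (N + 3 : ℕ))) :
    ∫⁻ x, ENNReal.ofReal (‖x‖ ^ 2 / gauge K x ^ 4 * f x) ≤
      ENNReal.ofReal (5 * m ^ 2) * ∫⁻ x in K, ENNReal.ofReal (‖x‖ ^ 2) := by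
  have hgc : Continuous (gauge K) := continuous_gauge hcv hK0
  have hgm : Measurable (gauge K) := hgc.measurable
  rw [← lintegral_indicator hK.measurableSet, polar _ (by fun_prop),
    polar _ ((by fun_prop : Measurable fun x : EuclideanSpace ℝ (Fin (N + 3)) =>
      ENNReal.ofReal (‖x‖ ^ 2)).indicator hK.measurableSet),
    ← lintegral_const_mul' _ _ ENNReal.ofReal_ne_top]
  refine lintegral_mono fun θ => ?_
  have hθn : ‖θ.1‖ = 1 := by simpa using θ.2
  have hθ0 : θ.1 ≠ 0 := by
    intro h; rw [h] at hθn; simp at hθn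
  have hgθ := hgp _ hθ0
  have hgr : ∀ r : ℝ, 0 < r → gauge K (r • θ.1) = r * gauge K θ.1 := fun r hr => by
    rw [gauge_smul_of_nonneg hr.le, smul_eq_mul]
  have hgt := hg _ hθ0
  set c := (gauge K θ.1)⁻¹ with hc
  have hcp : 0 < c := inv_pos.2 hgθ
  have hgc' : gauge K θ.1 = c⁻¹ := by rw [hc, inv_inv]
  have hpow : ∫ r in Ioi (0 : ℝ), r ^ (((N + 3 : ℕ) : ℝ) - 1) * f (r • θ.1) =
      ∫ r in Ioi (0 : ℝ), r ^ (N + 2) * f (r • θ.1) := by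
    refine setIntegral_congr_fun measurableSet_Ioi fun r hr => ?_
    have : ((N + 3 : ℕ) : ℝ) - 1 = ((N + 2 : ℕ) : ℝ) := by push_cast; ring
    simp only [this, Real.rpow_natCast]
  rw [hpow] at hgt
  have hJ0 : 0 ≤ ∫ r in Ioi (0 : ℝ), r ^ (N + 2) * f (r • θ.1) :=
    setIntegral_nonneg measurableSet_Ioi fun r hr => mul_nonneg (pow_nonneg (le_of_lt hr) _) (h0 _)
  have hv : ((N : ℝ) + 3) * ∫ r in Ioi (0 : ℝ), r ^ (N + 2) * f (r • θ.1) = c ^ (N + 3) := by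
    rw [hgt, one_div, Real.rpow_inv_natCast_pow (by positivity) (by omega)]
    push_cast; rfl
  have hi : IntegrableOn (fun r => r ^ (N + 2) * f (r • θ.1)) (Ioi 0) := by
    by_contra h
    rw [integral_undef h, mul_zero] at hv
    exact absurd hv.symm (by positivity)
  have hmom := moment (fun r => f (r • θ.1)) c m hcp hm (fun r => h0 _) (fun r => hM _) hi hv
  have hL : ∫⁻ r in Ioi (0 : ℝ), ENNReal.ofReal (r ^ (N + 2)) *
      ENNReal.ofReal (‖r • θ.1‖ ^ 2 / gauge K (r • θ.1) ^ 4 * f (r • θ.1)) =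
      ENNReal.ofReal (c ^ 4) * ∫⁻ r in Ioi (0 : ℝ), ENNReal.ofReal (r ^ N * f (r • θ.1)) := by
    rw [← lintegral_const_mul' _ _ ENNReal.ofReal_ne_top]
    refine setLIntegral_congr_fun measurableSet_Ioi fun r hr => ?_
    have hr : 0 < r := hr
    rw [← ENNReal.ofReal_mul (by positivity), ← ENNReal.ofReal_mul (by positivity), hgr r hr,
      norm_smul, hθn, Real.norm_of_nonneg hr.le, hgc']
    congr 1
    field_simp
    ring
  have hRr : ∫⁻ r in Ioi (0 : ℝ), ENNReal.ofReal (r ^ (N + 2)) *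
      K.indicator (fun x => ENNReal.ofReal (‖x‖ ^ 2)) (r • θ.1) =
      ENNReal.ofReal (c ^ (N + 5) / (N + 5)) := by
    have e1 : ∫⁻ r in Ioi (0 : ℝ), ENNReal.ofReal (r ^ (N + 2)) *
      K.indicator (fun x => ENNReal.ofReal (‖x‖ ^ 2)) (r • θ.1) =
        ∫⁻ r in Ioi (0 : ℝ), (Ioc 0 c).indicator (fun r => ENNReal.ofReal (r ^ (N + 4))) r := by
      refine setLIntegral_congr_fun measurableSet_Ioi fun r hr => ?_
      have hr : 0 < r := hr
      have hiff : r • θ.1 ∈ K ↔ r ∈ Ioc 0 c := by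
        rw [← hK.isClosed.closure_eq, ← gauge_le_one_iff_mem_closure hcv hK0, hgr r hr, hgc',
          ← div_eq_mul_inv, div_le_one hcp]
        simp [hr]
      by_cases h : r ∈ Ioc 0 c
      · rw [indicator_of_mem h, indicator_of_mem (hiff.2 h), ← ENNReal.ofReal_mul (by positivity),
          norm_smul, hθn, Real.norm_of_nonneg hr.le]
        congr 1
        ring
      · rw [indicator_of_notMem h, indicator_of_notMem (fun h' => h (hiff.1 h')), mul_zero]
    rw [e1, setLIntegral_indicator measurableSet_Ioc, inter_eq_left.2 Ioc_subset_Ioi_self,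
      ← ofReal_integral_eq_lintegral_ofReal (intervalIntegral.intervalIntegrable_pow _).1,
      ← intervalIntegral.integral_of_le hcp.le, integral_pow]
    · congr 1
      push_cast
      rw [zero_pow (by omega), sub_zero]
      congr 1
      ring
    · filter_upwards [ae_restrict_mem measurableSet_Ioc] with y hy
      exact pow_nonneg hy.1.le _
  refine hL.trans_le ?_
  refine le_trans ?_ (mul_le_mul_right hRr.ge _)
  refine (mul_le_mul_right hmom _).trans ?_
  rw [← ENNReal.ofReal_mul (by positivity), ← ENNReal.ofReal_mul (by positivity)]
  refine ENNReal.ofReal_le_ofReal ?_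
  have hN : (0 : ℝ) ≤ N := Nat.cast_nonneg _
  have e3 : c ^ 4 * (m ^ 2 * c ^ (N + 1) / (N + 1)) = m ^ 2 * c ^ (N + 5) / (N + 1) := by ring
  rw [e3, mul_div_assoc', div_le_div_iff₀ (by positivity) (by positivity)]
  have : 0 < m ^ 2 * c ^ (N + 5) := by positivity
  nlinarith [mul_nonneg this.le hN]

theorem stmt_15 :
    ∃ C : ℝ, 0 < C ∧
      ∀ (n : ℕ), 3 ≤ n → ∀ (f : EuclideanSpace ℝ (Fin n) → ℝ)
        (K : Set (EuclideanSpace ℝ (Fin n))) (R : ℝ), 0 < R →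
        (∀ x, 0 ≤ f x) → UpperSemicontinuous f → Integrable f → (∫ x, f x = 1) →
        (∀ x y : EuclideanSpace ℝ (Fin n), ∀ t ∈ Icc (0 : ℝ) 1,
          f x ^ t * f y ^ (1 - t) ≤ f (t • x + (1 - t) • y)) →
        (Integrable fun x => f x • x) →
        (∫ x, f x • x = (0 : EuclideanSpace ℝ (Fin n))) →
        Convex ℝ K → IsCompact K → (0 : EuclideanSpace ℝ (Fin n)) ∈ interior K →
        (∀ x : EuclideanSpace ℝ (Fin n), x ≠ 0 → (gauge K x)⁻¹ =
          ((n : ℝ) * ∫ r in Ioi (0 : ℝ), r ^ ((n : ℝ) - 1) * f (r • x)) ^ ((1 : ℝ) / n)) →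
        closedBall (0 : EuclideanSpace ℝ (Fin n)) R ⊆ K →
        ∫ x, ‖fderiv ℝ (fun y => (gauge K y)⁻¹ • y) x‖ ^ 2 * f x ≤
          C * (f 0) ^ ((2 : ℝ) / n) / R ^ 2 * ∫ x in K, ‖x‖ ^ 2 := by
  refine ⟨1280, by norm_num, ?_⟩
  intro n hn f K R hR h0 husc hint h1 hlc hbi hb hcv hK hKi hg hball
  obtain ⟨N, rfl⟩ : ∃ N, n = N + 3 := ⟨n - 3, by omega⟩
  obtain ⟨hf0, hfM⟩ := frad f h0 husc hint h1 hlc hbi hb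
  have hK0 : K ∈ nhds 0 := mem_interior_iff_mem_nhds.1 hKi
  have hgp : ∀ x, x ≠ 0 → 0 < gauge K x := fun x hx =>
    (gauge_pos (absorbent_nhds_zero hK0)
      ((NormedSpace.isVonNBounded_iff ℝ).2 hK.isBounded)).2 hx
  have hgm : Measurable (gauge K) := (continuous_gauge hcv hK0).measurable
  have hmeas : Measurable f := husc.measurable
  set m : ℝ := 4 * f 0 ^ ((1 : ℝ) / (N + 3 : ℕ)) with hm
  have hmp : 0 < m := by positivity
  have hmn : m ^ (N + 3) = 4 ^ (N + 3) * f 0 := by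
    rw [hm, mul_pow, one_div, Real.rpow_inv_natCast_pow hf0.le (by omega)]
  have hm2 : m ^ 2 = 16 * f 0 ^ ((2 : ℝ) / (N + 3 : ℕ)) := by
    rw [hm, mul_pow, ← Real.rpow_mul_natCast hf0.le]
    norm_num
    congr 1
    ring
  have hmain := main_lintegral f K m hmp h0 hmeas (fun x => by rw [hmn]; exact hfM x) hcv hK hK0 hgp hg
  have hKint : IntegrableOn (fun x : EuclideanSpace ℝ (Fin (N + 3)) => ‖x‖ ^ 2) K :=
    (by fun_prop : Continuous fun x : EuclideanSpace ℝ (Fin (N + 3)) => ‖x‖ ^ 2).continuousOn.integrableOn_compact hK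
  have hJ0 : 0 ≤ ∫ x in K, ‖x‖ ^ 2 := integral_nonneg fun x => by positivity
  rw [← ofReal_integral_eq_lintegral_ofReal hKint (.of_forall fun x => by positivity),
    ← ENNReal.ofReal_mul (by positivity)] at hmain
  have hHnn : ∀ x, 0 ≤ ‖x‖ ^ 2 / gauge K x ^ 4 * f x := fun x => mul_nonneg (by positivity) (h0 x)
  have hHm : Measurable fun x => ‖x‖ ^ 2 / gauge K x ^ 4 * f x := by fun_prop
  have hH : Integrable fun x => ‖x‖ ^ 2 / gauge K x ^ 4 * f x := by
    refine ⟨hHm.aestronglyMeasurable, ?_⟩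
    rw [hasFiniteIntegral_iff_ofReal (.of_forall hHnn)]
    exact hmain.trans_lt ENNReal.ofReal_lt_top
  have hHv : ∫ x, ‖x‖ ^ 2 / gauge K x ^ 4 * f x ≤ 5 * m ^ 2 * ∫ x in K, ‖x‖ ^ 2 := by
    rw [← ofReal_integral_eq_lintegral_ofReal hH (.of_forall hHnn)] at hmain
    exact (ENNReal.ofReal_le_ofReal_iff (by positivity)).1 hmain
  have hne : ∀ᵐ x : EuclideanSpace ℝ (Fin (N + 3)), x ≠ 0 := by
    simp [ae_iff, measure_singleton]
  calc ∫ x, ‖fderiv ℝ (fun y => (gauge K y)⁻¹ • y) x‖ ^ 2 * f x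
      ≤ ∫ x, 16 / R ^ 2 * (‖x‖ ^ 2 / gauge K x ^ 4 * f x) := by
        refine integral_mono_of_nonneg (.of_forall fun x => mul_nonneg (by positivity) (h0 x))
          (hH.const_mul _) ?_
        filter_upwards [hne] with x hx
        have hgx := hgp x hx
        have hd := radial_fderiv K R hR hcv hball x hgx
        have hd2 := pow_le_pow_left₀ (norm_nonneg _) hd 2
        calc _ ≤ (4 * ‖x‖ / (R * gauge K x ^ 2)) ^ 2 * f x := mul_le_mul_of_nonneg_right hd2 (h0 x)
          _ = _ := by field_simp; ring
    _ = 16 / R ^ 2 * ∫ x, ‖x‖ ^ 2 / gauge K x ^ 4 * f x := integral_const_mul _ _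
    _ ≤ 16 / R ^ 2 * (5 * m ^ 2 * ∫ x in K, ‖x‖ ^ 2) := by gcongr
    _ = _ := by rw [hm2]; ring
end

section
/- For p ∈ [2, ∞) let μ_p be the probability measure on ℝ with density (1/(2Γ(1/p+1)))exp(−|t|^p), μ_pⁿ its n-fold product, and T(x) = x/‖x‖_{K} the radial map onto the boundary of K = c_{p,n}B_pⁿ where c_{p,n}B_pⁿ is the Ball body of μ_pⁿ (volume 1, c_{p,n} ≍ n^{1/p}). Then ∫_{ℝⁿ} ‖dT*(x)‖²_op dμ_pⁿ(x) ≤ C·min(p, n) for a universal constant C. -/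
open MeasureTheory Metric Set
open scoped RealInnerProductSpace ENNReal Pointwise

lemma gam_le_one {x : ℝ} (h1 : 1 ≤ x) (h2 : x ≤ 2) : Real.Gamma x ≤ 1 := by
  have := Real.convexOn_Gamma.le_max_of_mem_Icc (x := 1) (y := 2) (z := x) (by simp) (by simp)
    ⟨h1, h2⟩
  simpa [Real.Gamma_one, Real.Gamma_two] using this

lemma gam_ge_half {x : ℝ} (h1 : 1 ≤ x) (h2 : x ≤ 2) : 1 ≤ 2 * Real.Gamma x := by
  have h3 : Real.Gamma (4 - x) ≤ 2 := by
    have := Real.convexOn_Gamma.le_max_of_mem_Icc (x := 2) (y := 3) (z := 4 - x) (by simp)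
      (by simp) ⟨by linarith, by linarith⟩
    have e3 : Real.Gamma 3 = 2 := by
      rw [show (3 : ℝ) = 2 + 1 by norm_num, Real.Gamma_add_one (by norm_num), Real.Gamma_two]
      norm_num
    rw [Real.Gamma_two, e3] at this
    simpa using this
  have hx : 0 < Real.Gamma x := Real.Gamma_pos_of_pos (by linarith)
  have hy : 0 < Real.Gamma (4 - x) := Real.Gamma_pos_of_pos (by linarith)
  have := Real.Gamma_mul_add_mul_le_rpow_Gamma_mul_rpow_Gamma (s := x) (t := 4 - x) (a := 1/2)
    (b := 1/2) (by linarith) (by linarith) (by norm_num) (by norm_num) (by norm_num)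
  rw [show (1/2 : ℝ) * x + 1/2 * (4 - x) = 2 by ring, Real.Gamma_two,
    ← Real.mul_rpow hx.le hy.le, ← Real.sqrt_eq_rpow, Real.one_le_sqrt] at this
  nlinarith

lemma gam_le_rpow (n : ℝ) (hn : 1 ≤ n) (k : ℕ) :
    ∀ x : ℝ, 0 ≤ x → x ≤ n → x ≤ k + 1 → Real.Gamma (x + 1) ≤ n ^ x := by
  induction k with
  | zero =>
    intro x h0 _ h1
    refine (gam_le_one (by linarith) (by norm_num at h1; linarith)).trans ?_
    exact Real.one_le_rpow hn h0
  | succ k ih =>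
    intro x h0 hxn hk
    by_cases h1 : x ≤ 1
    · refine (gam_le_one (by linarith) (by linarith)).trans ?_
      exact Real.one_le_rpow hn h0
    · push Not at h1
      have := ih (x - 1) (by linarith) (by linarith) (by push_cast at hk; linarith)
      rw [Real.Gamma_add_one (by linarith)]
      rw [sub_add_cancel, Real.rpow_sub_one (by linarith)] at this
      have hg : 0 < Real.Gamma x := Real.Gamma_pos_of_pos (by linarith)
      rw [le_div_iff₀ (by linarith)] at this
      nlinarith

lemma c_bound {p : ℝ} (hp : 2 ≤ p) {n : ℕ} (hn : 1 ≤ n) {c : ℝ} (hc : 0 < c)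
    (hv : volume (c • {x : EuclideanSpace ℝ (Fin n) | ∑ i, |x i| ^ p ≤ 1}) = 1) :
    c ^ 2 ≤ (n : ℝ) ^ (2 / p) := by
  have hn' : (1 : ℝ) ≤ n := by exact_mod_cast hn
  have hne : Nonempty (Fin n) := ⟨⟨0, hn⟩⟩
  have hvol : volume {x : EuclideanSpace ℝ (Fin n) | ∑ i, |x i| ^ p ≤ 1} =
      ENNReal.ofReal ((2 * Real.Gamma (1 / p + 1)) ^ n / Real.Gamma (n / p + 1)) := by
    have h := MeasureTheory.volume_sum_rpow_le (Fin n) (p := p) (by linarith) 1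
    have hpre : {x : EuclideanSpace ℝ (Fin n) | ∑ i, |x i| ^ p ≤ 1} =
        (@WithLp.ofLp 2 (Fin n → ℝ)) ⁻¹' {x : Fin n → ℝ | (∑ i, |x i| ^ p) ^ (1 / p) ≤ 1} := by
      ext x
      simp only [mem_ofPred_eq, mem_preimage]
      have : 0 ≤ ∑ i, |x i| ^ p := by positivity
      rw [one_div, Real.rpow_inv_le_iff_of_pos this zero_le_one (by linarith), Real.one_rpow]
    rw [hpre, (PiLp.volume_preserving_ofLp (Fin n)).measure_preimage, h]
    · simp
    · apply MeasurableSet.nullMeasurableSet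
      apply measurableSet_le <;> fun_prop
  rw [Measure.addHaar_smul, hvol, finrank_euclideanSpace, Fintype.card_fin,
    ← ENNReal.ofReal_mul (by positivity), ENNReal.ofReal_eq_one, abs_of_pos (by positivity)] at hv
  have hG : 0 < Real.Gamma (n / p + 1) := Real.Gamma_pos_of_pos (by positivity)
  have hle : Real.Gamma (n / p + 1) ≤ (n : ℝ) ^ (n / p : ℝ) := by
    have h1 : (n / p : ℝ) ≤ n := div_le_self (by positivity) (by linarith)
    exact gam_le_rpow n hn' n _ (by positivity) h1 (by linarith)
  have hz : 1 ≤ 2 * Real.Gamma (1 / p + 1) := by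
    have : 1 / p ≤ 1 := by rw [div_le_one (by linarith)]; linarith
    have : 0 ≤ 1 / p := by positivity
    exact gam_ge_half (by linarith) (by linarith)
  have hz' := one_le_pow₀ hz (n := n)
  have h1 : c ^ n ≤ ((n : ℝ) ^ (1 / p)) ^ n := by
    rw [← Real.rpow_natCast, ← Real.rpow_natCast, ← Real.rpow_mul (by positivity)]
    rw [show 1 / p * (n : ℝ) = n / p by ring]
    refine le_trans ?_ hle
    rw [Real.rpow_natCast]
    rw [mul_div_assoc', div_eq_one_iff_eq hG.ne'] at hv
    rw [← hv]
    exact le_mul_of_one_le_right (by positivity) hz'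
  have h2 : c ≤ (n : ℝ) ^ (1 / p) := le_of_pow_le_pow_left₀ (by lia) (by positivity) h1
  calc c ^ 2 ≤ ((n : ℝ) ^ (1 / p)) ^ 2 := by gcongr
    _ = _ := by rw [← Real.rpow_natCast, ← Real.rpow_mul (by positivity)]; congr 1; push_cast; ring

lemma gauge_eq {p : ℝ} (hp : 2 ≤ p) {n : ℕ} {c : ℝ} (hc : 0 < c) (y : EuclideanSpace ℝ (Fin n)) :
    gauge (c • {z : EuclideanSpace ℝ (Fin n) | ∑ i, |z i| ^ p ≤ 1}) y =
      c⁻¹ * (∑ i, |y i| ^ p) ^ (1 / p) := by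
  have hS : 0 ≤ ∑ i, |y i| ^ p := by positivity
  rw [gauge_smul_left_of_nonneg hc.le, Pi.smul_apply, smul_eq_mul, gauge_def']
  congr 1
  have : {r ∈ Set.Ioi (0 : ℝ) | r⁻¹ • y ∈ {z : EuclideanSpace ℝ (Fin n) | ∑ i, |z i| ^ p ≤ 1}} =
      {r | 0 < r ∧ (∑ i, |y i| ^ p) ^ (1 / p) ≤ r} := by
    ext r
    simp only [mem_ofPred_eq, mem_Ioi, PiLp.smul_apply, smul_eq_mul]
    refine and_congr_right fun hr => ?_
    have : ∀ i, |r⁻¹ * y i| ^ p = (r ^ p)⁻¹ * |y i| ^ p := fun i => by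
      rw [abs_mul, abs_of_pos (inv_pos.2 hr), Real.mul_rpow (by positivity) (by positivity),
        Real.inv_rpow hr.le]
    simp_rw [this]
    rw [← Finset.mul_sum, inv_mul_le_iff₀ (by positivity), mul_one, one_div,
      Real.rpow_inv_le_iff_of_pos hS hr.le (by linarith)]
  rw [this]
  set a := (∑ i, |y i| ^ p) ^ (1 / p) with ha
  have ha0 : 0 ≤ a := by positivity
  apply le_antisymm
  · apply le_of_forall_pos_le_add
    intro ε hε
    exact csInf_le ⟨0, fun r hr => hr.1.le⟩ ⟨by linarith, by linarith⟩
  · exact le_csInf ⟨a + 1, by linarith, by linarith⟩ fun r hr => hr.2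

/-- coordinate sum -/
noncomputable def SS (p : ℝ) {n : ℕ} (x : EuclideanSpace ℝ (Fin n)) : ℝ := ∑ i, |x i| ^ p

/-- derivative of SS -/
noncomputable def DS (p : ℝ) {n : ℕ} (x : EuclideanSpace ℝ (Fin n)) :
    EuclideanSpace ℝ (Fin n) →L[ℝ] ℝ :=
  ∑ i, (p * |x i| ^ (p - 2) * x i) • (EuclideanSpace.proj i : EuclideanSpace ℝ (Fin n) →L[ℝ] ℝ)

lemma SS_pos {p : ℝ} {n : ℕ} {x : EuclideanSpace ℝ (Fin n)} (hx : x ≠ 0) : 0 < SS p x := by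
  obtain ⟨i, hi⟩ : ∃ i, x i ≠ 0 := by
    by_contra! h
    exact hx (by ext i; simpa using h i)
  exact Finset.sum_pos' (fun j _ => by positivity) ⟨i, Finset.mem_univ _, by positivity⟩

lemma hasFDerivAt_SS {p : ℝ} (hp : 2 ≤ p) {n : ℕ} (x : EuclideanSpace ℝ (Fin n)) :
    HasFDerivAt (SS p) (DS p x) x := by
  unfold SS DS
  apply HasFDerivAt.fun_sum
  intro i _
  have h1 := hasDerivAt_abs_rpow (x i) (p := p) (by linarith)
  exact h1.comp_hasFDerivAt x (EuclideanSpace.proj (𝕜 := ℝ) i).hasFDerivAt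

lemma DS_apply {p : ℝ} {n : ℕ} (x v : EuclideanSpace ℝ (Fin n)) :
    DS p x v = ∑ i, (p * |x i| ^ (p - 2) * x i) * v i := by
  simp [DS]

lemma DS_self {p : ℝ} (hp : 2 ≤ p) {n : ℕ} (x : EuclideanSpace ℝ (Fin n)) :
    DS p x x = p * SS p x := by
  rw [DS_apply, SS, Finset.mul_sum]
  refine Finset.sum_congr rfl fun i _ => ?_
  by_cases h : x i = 0
  · simp [h, Real.zero_rpow (show p ≠ 0 by linarith)]
  · have : |x i| ^ p = |x i| ^ (p - 2) * |x i| ^ 2 := by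
      rw [← Real.rpow_natCast, ← Real.rpow_add (by positivity)]; norm_num
    rw [this, sq_abs]; ring

/-- gradient size -/
noncomputable def GG (p : ℝ) {n : ℕ} (x : EuclideanSpace ℝ (Fin n)) : ℝ :=
  ∑ i, |x i| ^ (2 * p - 2)

lemma DS_norm {p : ℝ} (hp : 2 ≤ p) {n : ℕ} (x : EuclideanSpace ℝ (Fin n)) :
    ‖DS p x‖ ≤ p * √(GG p x) := by
  refine ContinuousLinearMap.opNorm_le_bound _ (by positivity) fun v => ?_
  rw [DS_apply]
  have h1 : ∀ i, (p * |x i| ^ (p - 2) * x i) * v i = p * ((|x i| ^ (p - 2) * x i) * v i) :=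
    fun i => by ring
  simp_rw [h1]
  rw [← Finset.mul_sum, norm_mul, Real.norm_of_nonneg (show 0 ≤ p by linarith), mul_assoc]
  gcongr
  rw [Real.norm_eq_abs]
  have hG : 0 ≤ GG p x := by unfold GG; positivity
  refine abs_le_of_sq_le_sq ?_ (by positivity)
  rw [mul_pow, Real.sq_sqrt hG, EuclideanSpace.norm_sq_eq]
  refine (Finset.sum_mul_sq_le_sq_mul_sq _ _ _).trans (le_of_eq ?_)
  congr 1
  · refine Finset.sum_congr rfl fun i _ => ?_
    by_cases h : x i = 0
    · simp [h, Real.zero_rpow (show 2 * p - 2 ≠ 0 by linarith)]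
    · rw [mul_pow, ← sq_abs (x i), ← Real.rpow_natCast (|x i| ^ (p - 2)), ← Real.rpow_mul (by positivity),
        ← Real.rpow_natCast |x i|, ← Real.rpow_add (by positivity)]
      congr 1; push_cast; ring
  · simp

lemma normsq_le {p : ℝ} (hp : 2 ≤ p) {n : ℕ} (x : EuclideanSpace ℝ (Fin n)) :
    ‖x‖ ^ 2 ≤ (n : ℝ) ^ (1 - 2 / p) * SS p x ^ (2 / p) := by
  have h := Real.rpow_sum_le_const_mul_sum_rpow_of_nonneg (s := Finset.univ) (p := p / 2)
    (f := fun i => |x i| ^ 2) (by linarith) (fun i _ => by positivity)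
  have e : ∀ i, (|x i| ^ 2) ^ (p / 2) = |x i| ^ p := fun i => by
    rw [← Real.rpow_natCast, ← Real.rpow_mul (by positivity)]; congr 1; push_cast; ring
  simp_rw [e] at h
  rw [Finset.card_univ, Fintype.card_fin] at h
  have hS : 0 ≤ SS p x := by unfold SS; positivity
  have hn : ‖x‖ ^ 2 = ∑ i, |x i| ^ 2 := by
    rw [EuclideanSpace.norm_sq_eq]; simp
  rw [hn]
  have h2 := Real.rpow_le_rpow (by positivity) h (show 0 ≤ 2 / p by positivity)
  rw [← Real.rpow_mul (by positivity), show p / 2 * (2 / p) = 1 by field_simp, Real.rpow_one,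
    Real.mul_rpow (by positivity) (by positivity), ← Real.rpow_mul (by positivity),
    show (p / 2 - 1) * (2 / p) = 1 - 2 / p by field_simp] at h2
  exact h2

lemma SS_le {p : ℝ} (hp : 2 ≤ p) {n : ℕ} (x : EuclideanSpace ℝ (Fin n)) :
    SS p x ≤ ‖x‖ ^ p := by
  by_cases hx : x = 0
  · subst hx; simp [SS, Real.zero_rpow (show p ≠ 0 by linarith)]
  have hx' : 0 < ‖x‖ := norm_pos_iff.2 hx
  have h : ∀ i, |x i| ^ p ≤ |x i| ^ 2 * ‖x‖ ^ (p - 2) := fun i => by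
    by_cases h : x i = 0
    · simp [h, Real.zero_rpow (show p ≠ 0 by linarith)]
    have : |x i| ^ p = |x i| ^ 2 * |x i| ^ (p - 2)  := by
      rw [← Real.rpow_natCast, ← Real.rpow_add (by positivity)]; norm_num
    rw [this]
    have hi : |x i| ≤ ‖x‖ := PiLp.norm_apply_le x i
    have := Real.rpow_le_rpow (abs_nonneg _) hi (show 0 ≤ p - 2 by linarith)
    gcongr
  have hn : ‖x‖ ^ 2 = ∑ i, |x i| ^ 2 := by
    rw [EuclideanSpace.norm_sq_eq]; simp
  calc SS p x ≤ ∑ i, |x i| ^ 2 * ‖x‖ ^ (p - 2) := Finset.sum_le_sum fun i _ => h i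
    _ = ‖x‖ ^ 2 * ‖x‖ ^ (p - 2) := by rw [← Finset.sum_mul, hn]
    _ = ‖x‖ ^ p := by rw [← Real.rpow_natCast, ← Real.rpow_add (by positivity)]; norm_num

/-- the derivative -/
noncomputable def DT (p c : ℝ) {n : ℕ} (x : EuclideanSpace ℝ (Fin n)) :
    EuclideanSpace ℝ (Fin n) →L[ℝ] EuclideanSpace ℝ (Fin n) :=
  (c * SS p x ^ (-(1 / p))) • ContinuousLinearMap.id ℝ _ +
    ((c * (-(1 / p) * SS p x ^ (-(1 / p) - 1))) • DS p x).smulRight x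

lemma DT_apply (p c : ℝ) {n : ℕ} (x v : EuclideanSpace ℝ (Fin n)) :
    DT p c x v = (c * SS p x ^ (-(1 / p))) • v +
      ((c * (-(1 / p) * SS p x ^ (-(1 / p) - 1))) * DS p x v) • x := by
  simp [DT]

lemma hasFDerivAt_T {p : ℝ} (hp : 2 ≤ p) {n : ℕ} {c : ℝ} (hc : 0 < c)
    {x : EuclideanSpace ℝ (Fin n)} (hx : x ≠ 0) :
    HasFDerivAt (fun y : EuclideanSpace ℝ (Fin n) =>
      (gauge (c • {z : EuclideanSpace ℝ (Fin n) | ∑ i, |z i| ^ p ≤ 1}) y)⁻¹ • y) (DT p c x) x := by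
  have e : (fun y : EuclideanSpace ℝ (Fin n) =>
      (gauge (c • {z : EuclideanSpace ℝ (Fin n) | ∑ i, |z i| ^ p ≤ 1}) y)⁻¹ • y) =
      fun y => (c * SS p y ^ (-(1 / p))) • y := by
    ext1 y
    rw [gauge_eq hp hc, mul_inv, inv_inv, Real.rpow_neg (by unfold SS; positivity)]
    rfl
  rw [e]
  have hS := SS_pos (p := p) hx
  have h1 : HasDerivAt (fun s : ℝ => c * s ^ (-(1 / p)))
      (c * (-(1 / p) * SS p x ^ (-(1 / p) - 1))) (SS p x) :=
    (Real.hasDerivAt_rpow_const (Or.inl hS.ne')).const_mul c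
  exact (h1.comp_hasFDerivAt x (hasFDerivAt_SS hp x)).smul (hasFDerivAt_id x)

lemma DT_self {p : ℝ} (hp : 2 ≤ p) (c : ℝ) {n : ℕ} {x : EuclideanSpace ℝ (Fin n)} (hx : x ≠ 0) :
    DT p c x x = 0 := by
  have hS := SS_pos (p := p) hx
  rw [DT_apply, DS_self hp, ← add_smul]
  convert zero_smul ℝ x
  rw [Real.rpow_sub_one hS.ne']
  field_simp
  ring

lemma DT_norm_sq {p : ℝ} (hp : 2 ≤ p) {n : ℕ} {c : ℝ} (hc : 0 < c)
    {x : EuclideanSpace ℝ (Fin n)} (hx : x ≠ 0) :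
    ‖DT p c x‖ ^ 2 ≤ 4 * c ^ 2 * (n : ℝ) ^ (1 - 2 / p) * (GG p x / SS p x ^ 2) := by
  have hS := SS_pos (p := p) hx
  have hG : 0 ≤ GG p x := by unfold GG; positivity
  have hp0 : 0 < p := by linarith
  have hD := DS_norm hp x
  have hSx : SS p x ≤ √(GG p x) * ‖x‖ := by
    have h1 : p * SS p x ≤ p * √(GG p x) * ‖x‖ := by
      rw [← DS_self hp]
      exact (le_abs_self _).trans (((DS p x).le_opNorm x).trans (by gcongr))
    rw [mul_assoc] at h1
    exact le_of_mul_le_mul_left h1 hp0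
  set r := SS p x ^ (-(1 / p)) with hr
  have hr0 : 0 < r := by positivity
  have hN : ‖DT p c x‖ ≤ 2 * c * (r * (√(GG p x) * ‖x‖ / SS p x)) := by
    refine ContinuousLinearMap.opNorm_le_bound _ (by positivity) fun v => ?_
    rw [DT_apply, Real.rpow_sub_one hS.ne', ← hr]
    have h1 : ‖(c * r) • v‖ ≤ c * (r * (√(GG p x) * ‖x‖ / SS p x)) * ‖v‖ := by
      rw [norm_smul, Real.norm_of_nonneg (by positivity)]
      have : 1 ≤ √(GG p x) * ‖x‖ / SS p x := by rwa [one_le_div hS]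
      gcongr
      exact le_mul_of_one_le_right hr0.le this
    have h2 : ‖(c * (-(1 / p) * (r / SS p x)) * DS p x v) • x‖ ≤
        c * (r * (√(GG p x) * ‖x‖ / SS p x)) * ‖v‖ := by
      rw [norm_smul, norm_mul]
      have : ‖c * (-(1 / p) * (r / SS p x))‖ = c * (1 / p * (r / SS p x)) := by
        rw [neg_mul, mul_neg, norm_neg, Real.norm_of_nonneg (by positivity)]
      rw [this]
      have h3 : ‖DS p x v‖ ≤ p * √(GG p x) * ‖v‖ := ((DS p x).le_opNorm v).trans (by gcongr)
      calc _ ≤ c * (1 / p * (r / SS p x)) * (p * √(GG p x) * ‖v‖) * ‖x‖ := by gcongr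
        _ = _ := by field_simp
    calc _ ≤ _ := norm_add_le _ _
      _ ≤ _ := add_le_add h1 h2
      _ = _ := by ring
  have hr2 : r ^ 2 * SS p x ^ (2 / p) = 1 := by
    rw [hr, ← Real.rpow_natCast, ← Real.rpow_mul hS.le, ← Real.rpow_add hS]
    rw [show -(1 / p) * ((2 : ℕ) : ℝ) + 2 / p = 0 by push_cast; ring, Real.rpow_zero]
  calc ‖DT p c x‖ ^ 2 ≤ (2 * c * (r * (√(GG p x) * ‖x‖ / SS p x))) ^ 2 := by gcongr
    _ = 4 * c ^ 2 * r ^ 2 * (√(GG p x)) ^ 2 / SS p x ^ 2 * ‖x‖ ^ 2 := by ring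
    _ ≤ 4 * c ^ 2 * r ^ 2 * (√(GG p x)) ^ 2 / SS p x ^ 2 *
        ((n : ℝ) ^ (1 - 2 / p) * SS p x ^ (2 / p)) := by
      gcongr
      exact normsq_le hp x
    _ = 4 * c ^ 2 * (n : ℝ) ^ (1 - 2 / p) * (GG p x / SS p x ^ 2) *
        (r ^ 2 * SS p x ^ (2 / p)) := by
      rw [Real.sq_sqrt hG]; ring
    _ = _ := by rw [hr2, mul_one]

lemma DT_one {p : ℝ} (hp : 2 ≤ p) (c : ℝ) {x : EuclideanSpace ℝ (Fin 1)} (hx : x ≠ 0) :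
    DT p c x = 0 := by
  have h0 : x 0 ≠ 0 := by
    intro h
    apply hx
    ext i
    rw [Subsingleton.elim i 0, h]; rfl
  ext1 v
  have : v = (v 0 / x 0) • x := by
    ext i
    rw [Subsingleton.elim i 0]
    simp [h0]
  rw [this, map_smul, DT_self hp c hx]; simp

lemma DT_two {p : ℝ} (hp : 2 ≤ p) {c : ℝ} (hc : 0 < c) {x : EuclideanSpace ℝ (Fin 2)}
    (hx : x ≠ 0) : c * ‖x‖⁻¹ ≤ ‖DT p c x‖ := by
  have hS := SS_pos (p := p) hx
  have hx' : 0 < ‖x‖ := norm_pos_iff.2 hx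
  obtain ⟨v, hv0, hv⟩ : ∃ v : EuclideanSpace ℝ (Fin 2), v ≠ 0 ∧ DS p x v = 0 := by
    set a := DS p x (EuclideanSpace.single 0 1) with ha
    set b := DS p x (EuclideanSpace.single 1 1) with hb
    by_cases h : a = 0
    · exact ⟨_, by simp, h⟩
    · refine ⟨b • EuclideanSpace.single 0 1 - a • EuclideanSpace.single 1 1, ?_, ?_⟩
      · intro hh
        have := congrArg (fun w : EuclideanSpace ℝ (Fin 2) => w 1) hh
        simp at this
        exact h this
      · rw [map_sub, map_smul, map_smul, ← ha, ← hb]; simp [mul_comm]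
  have h1 := (DT p c x).le_opNorm v
  rw [DT_apply, hv, mul_zero, zero_smul, add_zero, norm_smul,
    Real.norm_of_nonneg (by positivity)] at h1
  have h2 := le_of_mul_le_mul_right h1 (norm_pos_iff.2 hv0)
  refine le_trans ?_ h2
  gcongr
  rw [Real.rpow_neg hS.le]
  gcongr
  rw [one_div, Real.rpow_inv_le_iff_of_pos hS.le hx'.le (by linarith)]
  exact SS_le hp x

/-- bundled one-dimensional integral -/
lemma one_dim {p q b : ℝ} (hp : 2 ≤ p) (hq : 0 ≤ q) (hb : 0 < b) :
    ∫ x : ℝ, |x| ^ q * Real.exp (-b * |x| ^ p) =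
      b ^ (-(q + 1) / p) * (2 / p * Real.Gamma ((q + 1) / p)) := by
  rw [integral_comp_abs (f := fun x => x ^ q * Real.exp (-b * x ^ p)),
    integral_rpow_mul_exp_neg_mul_rpow (by linarith) (by linarith) hb]
  ring

lemma one_dim_int {p q b : ℝ} (hp : 2 ≤ p) (hq : 0 ≤ q) (hb : 0 < b) :
    Integrable fun x : ℝ => |x| ^ q * Real.exp (-b * |x| ^ p) := by
  apply Integrable.of_integral_ne_zero
  rw [one_dim hp hq hb]
  have : 0 < Real.Gamma ((q + 1) / p) := Real.Gamma_pos_of_pos (by positivity)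
  positivity

lemma multi {p b : ℝ} (hp : 2 ≤ p) (hb : 0 < b) {n : ℕ} (k : Fin n) :
    ∫⁻ x : Fin n → ℝ, ENNReal.ofReal (|x k| ^ (2 * p - 2) * Real.exp (-b * ∑ i, |x i| ^ p)) =
      ENNReal.ofReal (b ^ (-2 - ((n : ℝ) - 2) / p) * (2 / p * Real.Gamma (2 - 1 / p)) *
        (2 * Real.Gamma (1 / p + 1)) ^ (n - 1)) := by
  have hp0 : 0 < p := by linarith
  let q : Fin n → ℝ := fun i => if i = k then 2 * p - 2 else 0
  have hq : ∀ i, 0 ≤ q i := fun i => by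
    simp only [q]; split_ifs <;> linarith
  have e : ∀ x : Fin n → ℝ, |x k| ^ (2 * p - 2) * Real.exp (-b * ∑ i, |x i| ^ p) =
      ∏ i, (|x i| ^ (q i) * Real.exp (-b * |x i| ^ p)) := fun x => by
    rw [Finset.prod_mul_distrib, ← Real.exp_sum, Finset.mul_sum]
    congr 1
    rw [Finset.prod_eq_single k]
    · simp [q]
    · intro i _ hi; simp [q, hi]
    · simp
  simp_rw [e]
  rw [volume_pi, ← ofReal_integral_eq_lintegral_ofReal
    (Integrable.fintype_prod (f := fun i x => |x| ^ (q i) * Real.exp (-b * |x| ^ p))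
      fun i => one_dim_int hp (hq i) hb)
    (Filter.Eventually.of_forall fun x => by positivity)]
  congr 1
  rw [integral_fintype_prod_eq_prod
    (f := fun i x => |x| ^ (q i) * Real.exp (-b * |x| ^ p))]
  simp_rw [one_dim hp (hq _) hb]
  rw [← Finset.mul_prod_erase _ _ (Finset.mem_univ k)]
  have h2 : ∀ i ∈ Finset.univ.erase k,
      b ^ (-(q i + 1) / p) * (2 / p * Real.Gamma ((q i + 1) / p)) =
      b ^ (-1 / p) * (2 * Real.Gamma (1 / p + 1)) := fun i hi => by
    have : q i = 0 := by simp [q, Finset.ne_of_mem_erase hi]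
    rw [this, Real.Gamma_add_one (by positivity), zero_add]; ring
  rw [Finset.prod_congr rfl h2, Finset.prod_const, Finset.card_erase_of_mem (Finset.mem_univ k),
    Finset.card_univ, Fintype.card_fin, mul_pow]
  have hqk : q k = 2 * p - 2 := by simp [q]
  have hn : 1 ≤ n := Nat.one_le_iff_ne_zero.2 (by rintro rfl; exact k.elim0)
  rw [hqk, ← Real.rpow_natCast (b ^ (-1 / p)), ← Real.rpow_mul hb.le, Nat.cast_sub hn,
    show (2 * p - 2 + 1) / p = 2 - 1 / p by field_simp; ring]
  have : b ^ (-2 - ((n : ℝ) - 2) / p) =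
      b ^ (-(2 * p - 2 + 1) / p) * b ^ (-1 / p * ((n : ℝ) - (1 : ℕ))) := by
    rw [← Real.rpow_add hb]; congr 1; push_cast; field_simp; ring
  rw [this]; ring

lemma outer {s : ℝ} (hs : 0 < s) :
    ∫⁻ t in Ioi (0 : ℝ), ENNReal.ofReal (t * (t + 1) ^ (-2 - s)) ≤
      ENNReal.ofReal (1 / (s * (s + 1))) := by
  have i1 := integrableOn_add_rpow_Ioi_of_lt (a := -1 - s) (c := 0) (m := 1) (by linarith)
    (by norm_num)
  have i2 := integrableOn_add_rpow_Ioi_of_lt (a := -2 - s) (c := 0) (m := 1) (by linarith)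
    (by norm_num)
  have ev : ∀ a : ℝ, a < -1 → ∫ t in Ioi (0 : ℝ), (t + 1) ^ a = -1 / (a + 1) := fun a ha => by
    have h := (measurePreserving_add_right volume (1 : ℝ)).setIntegral_preimage_emb
      (measurableEmbedding_addRight 1) (fun t : ℝ => t ^ a) (Ioi 1)
    have hpre : (fun x : ℝ => x + 1) ⁻¹' Ioi 1 = Ioi 0 := by ext x; simp
    rw [hpre] at h
    rw [h, integral_Ioi_rpow_of_lt ha one_pos, Real.one_rpow]
  have e : ∀ t ∈ Ioi (0 : ℝ), t * (t + 1) ^ (-2 - s) = (t + 1) ^ (-1 - s) - (t + 1) ^ (-2 - s) := by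
    intro t ht
    have ht : 0 < t := ht
    rw [show -1 - s = (-2 - s) + 1 by ring, Real.rpow_add_one (by positivity)]; ring
  have hI : IntegrableOn (fun t : ℝ => t * (t + 1) ^ (-2 - s)) (Ioi 0) :=
    (integrableOn_congr_fun e measurableSet_Ioi).2 (i1.sub i2)
  rw [← ofReal_integral_eq_lintegral_ofReal hI]
  · apply ENNReal.ofReal_le_ofReal
    rw [setIntegral_congr_fun measurableSet_Ioi e, integral_sub i1 i2, ev _ (by linarith),
      ev _ (by linarith)]
    apply le_of_eq
    have : (-1 - s + 1) ≠ 0 := by linarith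
    have : (-2 - s + 1) ≠ 0 := by linarith
    have : s + 1 ≠ 0 := by linarith
    field_simp
    ring
  · filter_upwards [ae_restrict_mem measurableSet_Ioi] with t ht
    have ht : 0 < t := ht
    change 0 ≤ t * (t + 1) ^ (-2 - s)
    positivity

lemma inner_t {S w : ℝ} (hS : 0 < S) (hw : 0 ≤ w) :
    ENNReal.ofReal (w / S ^ 2 * Real.exp (-S)) =
      ∫⁻ t in Ioi (0 : ℝ), ENNReal.ofReal (t * (w * Real.exp (-(t + 1) * S))) := by
  have h1 := integral_rpow_mul_exp_neg_mul_rpow (p := 1) (q := 1) (b := S) one_pos (by norm_num) hS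
  have i1 := integrableOn_rpow_mul_exp_neg_mul_rpow (p := 1) (s := 1) (b := S) (by norm_num)
    one_pos hS
  simp only [Real.rpow_one] at h1 i1
  have hG : Real.Gamma ((1 + 1) / 1) = 1 := by norm_num [Real.Gamma_two]
  rw [hG] at h1
  have e : ∀ t, t * (w * Real.exp (-(t + 1) * S)) = w * Real.exp (-S) * (t * Real.exp (-S * t)) :=
    fun t => by
      rw [show -(t + 1) * S = -S + -S * t by ring, Real.exp_add]; ring
  simp_rw [e]
  rw [← ofReal_integral_eq_lintegral_ofReal (i1.const_mul _)]
  · rw [integral_const_mul, h1]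
    congr 1
    rw [show (-(1 + 1) / 1 : ℝ) = -(2 : ℕ) by norm_num, Real.rpow_neg hS.le, Real.rpow_natCast]
    ring
  · filter_upwards [ae_restrict_mem measurableSet_Ioi] with t ht
    have ht : 0 < t := ht
    change 0 ≤ w * Real.exp (-S) * (t * Real.exp (-S * t))
    positivity

lemma key {p : ℝ} (hp : 2 ≤ p) {n : ℕ} (hn : 3 ≤ n) (k : Fin n) :
    ∫⁻ x : Fin n → ℝ, ENNReal.ofReal
      (|x k| ^ (2 * p - 2) / (∑ i, |x i| ^ p) ^ 2 * Real.exp (-∑ i, |x i| ^ p)) ≤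
    ENNReal.ofReal ((2 / p) * (2 * Real.Gamma (1 / p + 1)) ^ (n - 1) *
      (p ^ 2 / (((n : ℝ) - 2) * ((n : ℝ) - 2 + p)))) := by
  have hp0 : 0 < p := by linarith
  have hn' : (3 : ℝ) ≤ n := by exact_mod_cast hn
  have hZ : 0 < Real.Gamma (1 / p + 1) := Real.Gamma_pos_of_pos (by positivity)
  have hp1 : 1 / p ≤ 1 := by rw [div_le_one hp0]; linarith
  have hp2 : 0 < 1 / p := by positivity
  have hA : Real.Gamma (2 - 1 / p) ≤ 1 := gam_le_one (by linarith) (by linarith)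
  have hA0 : 0 < Real.Gamma (2 - 1 / p) := Real.Gamma_pos_of_pos (by linarith)
  set s : ℝ := ((n : ℝ) - 2) / p with hs
  have hs0 : 0 < s := by apply div_pos <;> linarith
  calc _ ≤ ∫⁻ x : Fin n → ℝ, ∫⁻ t in Ioi (0 : ℝ), ENNReal.ofReal (t * (|x k| ^ (2 * p - 2) *
        Real.exp (-(t + 1) * ∑ i, |x i| ^ p))) := by
        refine lintegral_mono fun x => ?_
        by_cases h : 0 < ∑ i, |x i| ^ p
        · exact (inner_t h (by positivity)).le
        · have : ∑ i, |x i| ^ p = 0 := le_antisymm (not_lt.1 h) (by positivity)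
          simp [this]
    _ = ∫⁻ t in Ioi (0 : ℝ), ∫⁻ x : Fin n → ℝ, ENNReal.ofReal (t * (|x k| ^ (2 * p - 2) *
        Real.exp (-(t + 1) * ∑ i, |x i| ^ p))) := by
        apply lintegral_lintegral_swap
        apply Measurable.aemeasurable
        simp only [Function.uncurry_def]
        fun_prop
    _ = ∫⁻ t in Ioi (0 : ℝ), ENNReal.ofReal ((2 / p * Real.Gamma (2 - 1 / p)) *
        (2 * Real.Gamma (1 / p + 1)) ^ (n - 1)) * ENNReal.ofReal (t * (t + 1) ^ (-2 - s)) := by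
        refine setLIntegral_congr_fun measurableSet_Ioi fun t ht => ?_
        have ht : 0 < t := ht
        simp_rw [ENNReal.ofReal_mul ht.le]
        rw [lintegral_const_mul' _ _ ENNReal.ofReal_ne_top, multi hp (by linarith) k,
          ← ENNReal.ofReal_mul ht.le, ← ENNReal.ofReal_mul ht.le,
          ← ENNReal.ofReal_mul (by positivity)]
        congr 1
        ring
    _ ≤ ENNReal.ofReal ((2 / p * Real.Gamma (2 - 1 / p)) *
        (2 * Real.Gamma (1 / p + 1)) ^ (n - 1)) * ENNReal.ofReal (1 / (s * (s + 1))) := by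
        rw [lintegral_const_mul' _ _ ENNReal.ofReal_ne_top]
        gcongr
        exact outer hs0
    _ ≤ _ := by
        rw [← ENNReal.ofReal_mul (by positivity)]
        apply ENNReal.ofReal_le_ofReal
        have : 1 / (s * (s + 1)) = p ^ 2 / (((n : ℝ) - 2) * ((n : ℝ) - 2 + p)) := by
          have : (n : ℝ) - 2 ≠ 0 := by linarith
          have : (n : ℝ) - 2 + p ≠ 0 := by linarith
          rw [hs]; field_simp
        rw [← this]
        gcongr
        exact mul_le_of_le_one_right (by positivity) hA

lemma key' {p : ℝ} (hp : 2 ≤ p) {n : ℕ} (hn : 3 ≤ n) :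
    Integrable (fun x : EuclideanSpace ℝ (Fin n) => GG p x / SS p x ^ 2 * Real.exp (-SS p x)) ∧
    ∫ x : EuclideanSpace ℝ (Fin n), GG p x / SS p x ^ 2 * Real.exp (-SS p x) ≤
      n * ((2 / p) * (2 * Real.Gamma (1 / p + 1)) ^ (n - 1) *
      (p ^ 2 / (((n : ℝ) - 2) * ((n : ℝ) - 2 + p)))) := by
  have hn' : (3 : ℝ) ≤ n := by exact_mod_cast hn
  have hZ : 0 < Real.Gamma (1 / p + 1) := Real.Gamma_pos_of_pos (by positivity)
  have hn2 : 0 < (n : ℝ) - 2 := by linarith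
  set R := ((2 / p) * (2 * Real.Gamma (1 / p + 1)) ^ (n - 1) *
      (p ^ 2 / (((n : ℝ) - 2) * ((n : ℝ) - 2 + p)))) with hR
  have hR0 : 0 ≤ R := by positivity
  have hm : Measurable
      (fun x : EuclideanSpace ℝ (Fin n) => GG p x / SS p x ^ 2 * Real.exp (-SS p x)) := by
    unfold GG SS; fun_prop
  have hnn : ∀ x : EuclideanSpace ℝ (Fin n), 0 ≤ GG p x / SS p x ^ 2 * Real.exp (-SS p x) :=
    fun x => by unfold GG SS; positivity
  have hl : ∫⁻ x : EuclideanSpace ℝ (Fin n),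
      ENNReal.ofReal (GG p x / SS p x ^ 2 * Real.exp (-SS p x)) ≤ ENNReal.ofReal (n * R) := by
    rw [← (PiLp.volume_preserving_toLp (Fin n)).lintegral_comp hm.ennreal_ofReal]
    simp only [GG, SS]
    simp_rw [Finset.sum_div, Finset.sum_mul]
    have : ∀ x : Fin n → ℝ, ENNReal.ofReal (∑ k, |x k| ^ (2 * p - 2) / (∑ i, |x i| ^ p) ^ 2 *
        Real.exp (-∑ i, |x i| ^ p)) = ∑ k, ENNReal.ofReal (|x k| ^ (2 * p - 2) /
        (∑ i, |x i| ^ p) ^ 2 * Real.exp (-∑ i, |x i| ^ p)) :=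
      fun x => ENNReal.ofReal_sum_of_nonneg fun i _ => by positivity
    simp_rw [this]
    rw [lintegral_finsetSum _ (fun k _ => by fun_prop)]
    refine (Finset.sum_le_sum fun k _ => key hp hn k).trans ?_
    rw [Finset.sum_const, Finset.card_univ, Fintype.card_fin, nsmul_eq_mul, ← hR,
      ENNReal.ofReal_mul (p := (n : ℝ)) (by positivity), ENNReal.ofReal_natCast]
  have hI : Integrable
      (fun x : EuclideanSpace ℝ (Fin n) => GG p x / SS p x ^ 2 * Real.exp (-SS p x)) := by
    refine ⟨hm.aestronglyMeasurable, ?_⟩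
    rw [hasFiniteIntegral_iff_ofReal (Filter.Eventually.of_forall hnn)]
    exact hl.trans_lt ENNReal.ofReal_lt_top
  refine ⟨hI, ?_⟩
  rw [← ofReal_integral_eq_lintegral_ofReal hI (Filter.Eventually.of_forall hnn)] at hl
  exact (ENNReal.ofReal_le_ofReal_iff (by positivity)).1 hl

lemma not_int_two {p : ℝ} (hp : 2 ≤ p) {c : ℝ} (hc : 0 < c) {w : ℝ} (hw : 0 < w) :
    ¬ Integrable (fun x : EuclideanSpace ℝ (Fin 2) =>
      ‖DT p c x‖ ^ 2 * (w * Real.exp (-SS p x))) := by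
  intro hI
  have h1 : IntegrableOn (fun x : EuclideanSpace ℝ (Fin 2) => (‖x‖ ^ 2)⁻¹) (ball 0 1) := by
    refine Integrable.mono' ((hI.const_mul (c ^ 2 * w * Real.exp (-1))⁻¹).integrableOn
      (s := ball 0 1)) (by fun_prop) ?_
    have hae : ∀ᵐ x : EuclideanSpace ℝ (Fin 2), x ≠ 0 := Measure.ae_ne volume 0
    filter_upwards [ae_restrict_mem measurableSet_ball, ae_restrict_of_ae hae] with x hx hx0
    have hx1 : ‖x‖ < 1 := by simpa using hx
    have hS : SS p x ≤ 1 := (SS_le hp x).trans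
      (Real.rpow_le_one (norm_nonneg _) hx1.le (by linarith))
    rw [Real.norm_of_nonneg (by positivity), le_inv_mul_iff₀ (by positivity)]
    calc c ^ 2 * w * Real.exp (-1) * (‖x‖ ^ 2)⁻¹ =
        (c * ‖x‖⁻¹) ^ 2 * (w * Real.exp (-1)) := by rw [mul_pow, inv_pow]; ring
      _ ≤ ‖DT p c x‖ ^ 2 * (w * Real.exp (-SS p x)) := by
        have := DT_two hp hc hx0
        gcongr
  rw [integrableOn_fun_norm_addHaar volume (f := fun r : ℝ => (r ^ 2)⁻¹)] at h1
  have h2 : IntegrableOn (fun r : ℝ => r ^ (-1 : ℝ)) (Ioo 0 1) := by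
    refine (integrableOn_congr_fun (fun r hr => ?_) measurableSet_Ioo).1 h1
    have : r ≠ 0 := hr.1.ne'
    simp only [finrank_euclideanSpace, Fintype.card_fin, smul_eq_mul]
    rw [Real.rpow_neg_one]
    field_simp
    norm_num
  rw [intervalIntegral.integrableOn_Ioo_rpow_iff one_pos] at h2
  exact lt_irrefl _ h2

/-- for `p ∈ [2,∞)`, let `μ_pⁿ` be the product measure with density
`Πᵢ (2Γ(1/p+1))⁻¹ exp(-|xᵢ|^p)` and let `K = c·B_pⁿ` be the (volume-one) Ball body of
`μ_pⁿ`. Then the radial map `T(x) = x/‖x‖_K` satisfies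
`∫ ‖dT*(x)‖²_op dμ_pⁿ(x) ≤ C·min(p,n)` for a universal constant `C`. -/
theorem stmt_17 :
    ∃ C : ℝ, 0 < C ∧
      ∀ (p : ℝ), 2 ≤ p → ∀ (n : ℕ), 1 ≤ n → ∀ c : ℝ, 0 < c →
        volume (c • {x : EuclideanSpace ℝ (Fin n) | ∑ i, |x i| ^ p ≤ 1}) = 1 →
        ∫ x : EuclideanSpace ℝ (Fin n),
            ‖fderiv ℝ (fun y : EuclideanSpace ℝ (Fin n) =>
                (gauge (c • {z : EuclideanSpace ℝ (Fin n) | ∑ i, |z i| ^ p ≤ 1}) y)⁻¹ • y)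
              x‖ ^ 2 *
            ((2 * Real.Gamma (1 / p + 1))⁻¹ ^ n * Real.exp (-∑ i, |x i| ^ p)) ≤
          C * min p (n : ℝ) := by
  refine ⟨72, by norm_num, ?_⟩
  intro p hp n hn c hc hv
  have hp0 : 0 < p := by linarith
  have hn' : (1 : ℝ) ≤ n := by exact_mod_cast hn
  have hZ : 0 < Real.Gamma (1 / p + 1) := Real.Gamma_pos_of_pos (by positivity)
  have hRHS : 0 ≤ 72 * min p (n : ℝ) := by positivity
  have hne : Nonempty (Fin n) := ⟨⟨0, hn⟩⟩
  have hae : ∀ᵐ x : EuclideanSpace ℝ (Fin n), x ≠ 0 := Measure.ae_ne volume 0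
  have hD : ∀ x : EuclideanSpace ℝ (Fin n), x ≠ 0 → fderiv ℝ (fun y : EuclideanSpace ℝ (Fin n) =>
      (gauge (c • {z : EuclideanSpace ℝ (Fin n) | ∑ i, |z i| ^ p ≤ 1}) y)⁻¹ • y) x = DT p c x :=
    fun x hx => (hasFDerivAt_T hp hc hx).fderiv
  have hcongr : ∫ x : EuclideanSpace ℝ (Fin n),
            ‖fderiv ℝ (fun y : EuclideanSpace ℝ (Fin n) =>
                (gauge (c • {z : EuclideanSpace ℝ (Fin n) | ∑ i, |z i| ^ p ≤ 1}) y)⁻¹ • y)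
              x‖ ^ 2 *
            ((2 * Real.Gamma (1 / p + 1))⁻¹ ^ n * Real.exp (-∑ i, |x i| ^ p)) =
      ∫ x : EuclideanSpace ℝ (Fin n),
        ‖DT p c x‖ ^ 2 * ((2 * Real.Gamma (1 / p + 1))⁻¹ ^ n * Real.exp (-SS p x)) := by
    apply integral_congr_ae
    filter_upwards [hae] with x hx
    rw [hD x hx]; rfl
  rw [hcongr]
  clear hcongr hD
  rcases (show n = 1 ∨ n = 2 ∨ 3 ≤ n by lia) with rfl | rfl | h3
  · rw [integral_eq_zero_of_ae]
    · exact hRHS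
    · filter_upwards [hae] with x hx
      simp [DT_one hp c hx]
  · rw [integral_undef (not_int_two hp hc (by positivity))]
    exact hRHS
  · obtain ⟨hI, hle⟩ := key' hp h3
    have hcb := c_bound hp hn hc hv
    have h3' : (3 : ℝ) ≤ n := by exact_mod_cast h3
    set Z := 2 * Real.Gamma (1 / p + 1) with hZd
    have hZ0 : 0 < Z := by positivity
    have hz : 1 ≤ Z := by
      have : 1 / p ≤ 1 := by rw [div_le_one hp0]; linarith
      have : 0 ≤ 1 / p := by positivity
      exact gam_ge_half (by linarith) (by linarith)
    set K := 4 * c ^ 2 * (n : ℝ) ^ (1 - 2 / p) * Z⁻¹ ^ n with hK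
    have hcn : c ^ 2 * (n : ℝ) ^ (1 - 2 / p) ≤ n := by
      calc c ^ 2 * (n : ℝ) ^ (1 - 2 / p) ≤ (n : ℝ) ^ (2 / p) * (n : ℝ) ^ (1 - 2 / p) := by gcongr
        _ = n := by rw [← Real.rpow_add (by linarith)]; simp
    have hn2 : 0 < (n : ℝ) - 2 := by linarith
    calc _ ≤ ∫ x : EuclideanSpace ℝ (Fin n),
          K * (GG p x / SS p x ^ 2 * Real.exp (-SS p x)) := by
          apply integral_mono_of_nonneg
          · exact Filter.Eventually.of_forall fun x => by
              change 0 ≤ ‖DT p c x‖ ^ 2 * (Z⁻¹ ^ n * Real.exp (-SS p x))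
              positivity
          · exact hI.const_mul K
          · filter_upwards [hae] with x hx
            calc _ ≤ 4 * c ^ 2 * (n : ℝ) ^ (1 - 2 / p) * (GG p x / SS p x ^ 2) *
                  (Z⁻¹ ^ n * Real.exp (-SS p x)) := by
                  gcongr
                  exact DT_norm_sq hp hc hx
              _ = _ := by rw [hK]; ring
      _ = K * ∫ x : EuclideanSpace ℝ (Fin n), GG p x / SS p x ^ 2 * Real.exp (-SS p x) :=
          integral_const_mul _ _
      _ ≤ K * (n * ((2 / p) * Z ^ (n - 1) *
            (p ^ 2 / (((n : ℝ) - 2) * ((n : ℝ) - 2 + p))))) := by gcongr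
      _ = 4 * (c ^ 2 * (n : ℝ) ^ (1 - 2 / p)) * n * (Z⁻¹ ^ n * Z ^ (n - 1)) * (2 * p) /
            (((n : ℝ) - 2) * ((n : ℝ) - 2 + p)) := by
          rw [hK]; field_simp
      _ ≤ 4 * n * n * 1 * (2 * p) / (((n : ℝ) - 2) * ((n : ℝ) - 2 + p)) := by
          have : Z⁻¹ ^ n * Z ^ (n - 1) ≤ 1 := by
            rw [inv_pow, inv_mul_le_iff₀ (by positivity), mul_one]
            exact pow_le_pow_right₀ hz (by lia)
          gcongr
      _ ≤ 4 * n * n * 1 * (2 * p) / (((n : ℝ) / 3) * (((n : ℝ) + p) / 3)) := by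
          gcongr <;> linarith
      _ = 72 * (n * p / (n + p)) := by field_simp; ring
      _ ≤ 72 * min p (n : ℝ) := by
          gcongr
          rw [le_min_iff, div_le_iff₀ (by positivity), div_le_iff₀ (by positivity)]
          constructor <;> nlinarith
end
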